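/- arXiv:1612.03792 — 8 statements merged into one kernel-verified Lean document; each statement's English description precedes it below -/
import Mathlib

section
/- Let K₁, K₂, K₃, K₄ ∈ ℝ. For a unit vector n ∈ ℝ³ and a real 3×3 matrix A, set c(A)_i = Σ_{j,k} ε_{ijk} A_{kj} and define W(n,A) = K₁(tr A)² + K₂(n·c(A))² + K₃|n × c(A)|² + (K₂+K₄)(tr(A²) − (tr A)²). Then there exists a constant c₀ > 0 such that W(n,A) ≥ c₀|A|² for every unit vector n ∈ ℝ³ and every real 3×3 matrix A satisfying Aᵀn = 0, if and only if the strict Ericksen inequalities hold: K₁ > 0, K₂ > 0, K₃ > 0, K₂ > |K₄|, and 2K₁ > K₂ + K₄. -/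
open scoped BigOperators

noncomputable section

/-- The Levi-Civita symbol on `Fin 3`. -/
def levicivita (i j k : Fin 3) : ℝ :=
  (((j : ℕ) : ℝ) - ((i : ℕ) : ℝ)) * (((k : ℕ) : ℝ) - ((i : ℕ) : ℝ)) *
    (((k : ℕ) : ℝ) - ((j : ℕ) : ℝ)) / 2

/-- The axial vector `c(A)`, with `c(A)_i = ∑_{j,k} ε_{ijk} A_{kj}`;
it corresponds to `curl n` when `A = ∇n`. -/
def axialVec (A : Matrix (Fin 3) (Fin 3) ℝ) : Fin 3 → ℝ :=
  fun i => ∑ j, ∑ k, levicivita i j k * A k j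

/-- The cross product in `ℝ³`. -/
def cross3 (u v : Fin 3 → ℝ) : Fin 3 → ℝ :=
  fun i => ∑ j, ∑ k, levicivita i j k * u j * v k

/-- The Oseen-Frank energy density evaluated algebraically at director `n`
and gradient matrix `A`:
`W(n,A) = K₁(tr A)² + K₂(n·c(A))² + K₃|n × c(A)|² + (K₂+K₄)(tr(A²) − (tr A)²)`. -/
def OseenFrankDensity (K₁ K₂ K₃ K₄ : ℝ) (n : Fin 3 → ℝ)
    (A : Matrix (Fin 3) (Fin 3) ℝ) : ℝ :=
  K₁ * (Matrix.trace A) ^ 2 + K₂ * (∑ i, n i * axialVec A i) ^ 2 +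
    K₃ * (∑ i, cross3 n (axialVec A) i ^ 2) +
    (K₂ + K₄) * (Matrix.trace (A * A) - (Matrix.trace A) ^ 2)

/-- For a vector `n` with `Aᵀ n = 0` one has `n × c(A) = -A n`. -/
lemma cross3_axialVec (n : Fin 3 → ℝ) (A : Matrix (Fin 3) (Fin 3) ℝ)
    (hA : A.transpose.mulVec n = 0) (i : Fin 3) :
    cross3 n (axialVec A) i = -A.mulVec n i := by
  have h := congrFun hA i
  fin_cases i <;>
  · simp [Matrix.mulVec, dotProduct, Fin.sum_univ_three, cross3, axialVec, levicivita] at h ⊢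
    linear_combination h

/-- The squared norm of `A` splits into its trace-square and its axial part. -/
lemma sum_sq_eq_trace_add (n : Fin 3 → ℝ) (A : Matrix (Fin 3) (Fin 3) ℝ)
    (hn : ∑ i, n i ^ 2 = 1) :
    ∑ i, ∑ j, A i j ^ 2 = Matrix.trace (A * A) + (∑ i, n i * axialVec A i) ^ 2 +
      ∑ i, cross3 n (axialVec A) i ^ 2 := by
  have h : (∑ i, n i * axialVec A i) ^ 2 + ∑ i, cross3 n (axialVec A) i ^ 2 =
      (∑ i, n i ^ 2) * ∑ i, axialVec A i ^ 2 := by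
    simp only [cross3, levicivita, Fin.sum_univ_three, Fin.val_zero, Fin.val_one, Fin.val_two]
    push_cast
    ring
  rw [add_assoc, h, hn, one_mul]
  simp [Matrix.trace, Matrix.mul_apply, axialVec, levicivita, Fin.sum_univ_three]
  ring

/-- The trace, twist and bend parts are controlled by the squared norm of `A`. -/
lemma trace_twist_bend_le (n : Fin 3 → ℝ) (A : Matrix (Fin 3) (Fin 3) ℝ)
    (hn : ∑ i, n i ^ 2 = 1) (hA : A.transpose.mulVec n = 0) :
    Matrix.trace A ^ 2 / 2 + (∑ i, n i * axialVec A i) ^ 2 / 2 +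
      ∑ i, cross3 n (axialVec A) i ^ 2 ≤ ∑ i, ∑ j, A i j ^ 2 := by
  simp only [cross3_axialVec n A hA]
  set g := A.mulVec n with hg
  have hg' : ∀ i, g i = A i 0 * n 0 + A i 1 * n 1 + A i 2 * n 2 := fun i => by
    simp [hg, Matrix.mulVec, dotProduct, Fin.sum_univ_three]
  have hng : n 0 * g 0 + n 1 * g 1 + n 2 * g 2 = 0 := by
    have h0 := congrFun hA 0
    have h1 := congrFun hA 1
    have h2 := congrFun hA 2
    simp [Matrix.mulVec, dotProduct, Fin.sum_univ_three] at h0 h1 h2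
    simp only [hg']
    linear_combination n 0 * h0 + n 1 * h1 + n 2 * h2
  have g0 := hg' 0
  have g1 := hg' 1
  have g2 := hg' 2
  clear_value g
  set s := Matrix.trace A with hs
  set u := ∑ i, n i * axialVec A i with hu
  have hs' : s = A 0 0 + A 1 1 + A 2 2 := by simp [hs, Matrix.trace, Fin.sum_univ_three]
  have hu' : u = n 0 * (A 2 1 - A 1 2) + n 1 * (A 0 2 - A 2 0) + n 2 * (A 1 0 - A 0 1) := by
    simp [hu, axialVec, levicivita, Fin.sum_univ_three]
    ring
  clear_value s u
  have key : 0 ≤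
      (A 0 0 - g 0 * n 0 - s / 2 * (1 - n 0 * n 0)) ^ 2 +
      (A 1 1 - g 1 * n 1 - s / 2 * (1 - n 1 * n 1)) ^ 2 +
      (A 2 2 - g 2 * n 2 - s / 2 * (1 - n 2 * n 2)) ^ 2 +
      (A 0 1 - g 0 * n 1 + s / 2 * (n 0 * n 1) + u / 2 * n 2) ^ 2 +
      (A 1 0 - g 1 * n 0 + s / 2 * (n 0 * n 1) - u / 2 * n 2) ^ 2 +
      (A 0 2 - g 0 * n 2 + s / 2 * (n 0 * n 2) - u / 2 * n 1) ^ 2 +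
      (A 2 0 - g 2 * n 0 + s / 2 * (n 0 * n 2) + u / 2 * n 1) ^ 2 +
      (A 1 2 - g 1 * n 2 + s / 2 * (n 1 * n 2) + u / 2 * n 0) ^ 2 +
      (A 2 1 - g 2 * n 1 + s / 2 * (n 1 * n 2) - u / 2 * n 0) ^ 2 := by positivity
  simp only [Fin.sum_univ_three] at hn ⊢
  rw [← sub_nonneg]
  refine key.trans_eq ?_
  linear_combination (g 0 ^ 2 + g 1 ^ 2 + g 2 ^ 2 + u ^ 2 / 2
      + s ^ 2 / 4 * (n 0 ^ 2 + n 1 ^ 2 + n 2 ^ 2 - 1)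
      - s * (n 0 * g 0 + n 1 * g 1 + n 2 * g 2)) * hn
    + s * hng + s * hs' + u * hu'
    + (2 * g 0 - s * n 0) * g0 + (2 * g 1 - s * n 1) * g1 + (2 * g 2 - s * n 2) * g2

/-- Coercivity `W(n,A) ≥ c₀|A|²` (over unit vectors `n` and matrices `A` with `Aᵀn = 0`)
holds for some `c₀ > 0` if and only if the strict Ericksen inequalities hold. -/
theorem ericksen_inequalities_iff_coercive (K₁ K₂ K₃ K₄ : ℝ) :
    (∃ c₀ : ℝ, 0 < c₀ ∧ ∀ (n : Fin 3 → ℝ) (A : Matrix (Fin 3) (Fin 3) ℝ),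
        (∑ i, n i ^ 2 = 1) → A.transpose.mulVec n = 0 →
        OseenFrankDensity K₁ K₂ K₃ K₄ n A ≥ c₀ * ∑ i, ∑ j, A i j ^ 2) ↔
      (0 < K₁ ∧ 0 < K₂ ∧ 0 < K₃ ∧ |K₄| < K₂ ∧ K₂ + K₄ < 2 * K₁) := by
  constructor
  · rintro ⟨c, hc, h⟩
    have hn : ∑ i, (![0, 0, 1] : Fin 3 → ℝ) i ^ 2 = 1 := by simp [Fin.sum_univ_three]
    have hW : ∀ a b d e p : ℝ,
        c * (a ^ 2 + b ^ 2 + d ^ 2 + e ^ 2 + p ^ 2) ≤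
          K₁ * (a + e) ^ 2 + K₂ * (d - b) ^ 2 + K₃ * p ^ 2 +
            2 * (K₂ + K₄) * (b * d - a * e) := by
      intro a b d e p
      have := h ![0, 0, 1] !![a, b, p; d, e, 0; 0, 0, 0] hn (by
        ext i
        fin_cases i <;> simp [Matrix.mulVec, dotProduct, Fin.sum_univ_three])
      simp [OseenFrankDensity, Matrix.trace, axialVec, cross3, levicivita,
        Fin.sum_univ_three] at this
      linarith
    have splay := hW 1 0 0 1 0
    have twist := hW 0 (-1) 1 0 0
    have bend := hW 0 0 0 0 1
    have saddle := hW 1 0 0 (-1) 0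
    norm_num at splay twist bend saddle
    refine ⟨by linarith, by linarith, by linarith, abs_lt.2 ⟨by linarith, by linarith⟩,
      by linarith⟩
  · rintro ⟨-, -, h₃, h₄, h₁⟩
    obtain ⟨h₅, h₆⟩ := abs_lt.1 h₄
    obtain ⟨c, hc, hc₁, hc₂, hc₃, hc₄⟩ : ∃ c : ℝ, 0 < c ∧ c ≤ 2 * K₁ - (K₂ + K₄) ∧
        c ≤ K₂ + K₄ ∧ c ≤ K₂ - K₄ ∧ c ≤ K₃ :=
      ⟨min (min (2 * K₁ - (K₂ + K₄)) (K₂ + K₄)) (min (K₂ - K₄) K₃),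
        lt_min (lt_min (by linarith) (by linarith)) (lt_min (by linarith) h₃),
        by simp, by simp, by simp, by simp⟩
    refine ⟨c, hc, fun n A hn hA => ?_⟩
    have hsplit := sum_sq_eq_trace_add n A hn
    have hrem := trace_twist_bend_le n A hn hA
    have hw : 0 ≤ ∑ i, cross3 n (axialVec A) i ^ 2 := Finset.sum_nonneg fun i _ => sq_nonneg _
    unfold OseenFrankDensity
    generalize ∑ i, cross3 n (axialVec A) i ^ 2 = w at *
    generalize ∑ i, n i * axialVec A i = u at *
    generalize ∑ i, ∑ j, A i j ^ 2 = N at *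
    rw [show Matrix.trace (A * A) = N - u ^ 2 - w by linarith]
    linarith [mul_nonneg (sub_nonneg.2 hc₁) (sq_nonneg A.trace),
      mul_nonneg (sub_nonneg.2 hc₂) (sub_nonneg.2 hrem),
      mul_nonneg (sub_nonneg.2 hc₃) (sq_nonneg u), mul_nonneg (sub_nonneg.2 hc₄) hw]
end
end

section
/- Let l₁, l₂, d > 0, let Ω = (0,l₁) × (0,l₂) × (0,d) ⊂ ℝ³, and let n be a continuously differentiable map from an open neighborhood of the closure of Ω into the unit sphere S² ⊂ ℝ³ satisfying n(x₁,x₂,0) = e₁ and n(x₁,x₂,d) = e₃ for all (x₁,x₂) ∈ (0,l₁) × (0,l₂), where e₁ = (1,0,0) and e₃ = (0,0,1). Then ∫_Ω |∇n(x)|² dx ≥ 2 l₁ l₂ / d. -/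
open scoped BigOperators
open MeasureTheory Set

noncomputable section

/-- The box `Ω = (0,l₁) × (0,l₂) × (0,d) ⊂ ℝ³`. -/
def box (l₁ l₂ d : ℝ) : Set (Fin 3 → ℝ) :=
  {x | x 0 ∈ Ioo 0 l₁ ∧ x 1 ∈ Ioo 0 l₂ ∧ x 2 ∈ Ioo 0 d}

/-- Squared Frobenius norm of the gradient of a vector field `n : ℝ³ → ℝ³`. -/
def gradNormSq (n : (Fin 3 → ℝ) → Fin 3 → ℝ) (x : Fin 3 → ℝ) : ℝ :=
  ∑ i, ∑ j, (fderiv ℝ (fun y => n y i) x (Pi.single j 1)) ^ 2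

/-- Integral over a box of a partial derivative of a `C¹` function that is constant on each of
the two open faces orthogonal to that direction. -/
theorem integral_fderiv_single_of_const_on_faces {m : ℕ} {a b : Fin (m + 1) → ℝ} (hle : a ≤ b)
    (i : Fin (m + 1)) {U : Set (Fin (m + 1) → ℝ)} (hU : IsOpen U) (hab : Icc a b ⊆ U)
    {g : (Fin (m + 1) → ℝ) → ℝ} (hg : ContDiffOn ℝ 1 g U) (ca cb : ℝ)
    (ha : ∀ y ∈ pi univ fun j => Ioo (a (i.succAbove j)) (b (i.succAbove j)),
      g (i.insertNth (a i) y) = ca)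
    (hb : ∀ y ∈ pi univ fun j => Ioo (a (i.succAbove j)) (b (i.succAbove j)),
      g (i.insertNth (b i) y) = cb) :
    ∫ x in Icc a b, fderiv ℝ g x (Pi.single i 1) =
      (cb - ca) * ∏ j, (b (i.succAbove j) - a (i.succAbove j)) := by
  have hderiv : ContinuousOn (fun x => fderiv ℝ g x (Pi.single i 1)) (Icc a b) :=
    ((hg.continuousOn_fderiv_of_isOpen hU le_rfl).clm_apply continuousOn_const).mono hab
  have hsum : ∀ x, ∑ j, (if j = i then fderiv ℝ g x else 0) (Pi.single j 1) =
      fderiv ℝ g x (Pi.single i 1) := by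
    intro x
    rw [Finset.sum_eq_single i] <;> simp +contextual
  have hface : ∀ (t c : ℝ),
      (∀ y ∈ pi univ fun j => Ioo (a (i.succAbove j)) (b (i.succAbove j)),
        g (i.insertNth t y) = c) →
      ∫ y in Icc (a ∘ i.succAbove) (b ∘ i.succAbove), g (i.insertNth t y) =
        c * ∏ j, (b (i.succAbove j) - a (i.succAbove j)) := by
    intro t c h
    have hae := Measure.univ_pi_Ioo_ae_eq_Icc (μ := fun _ : Fin m => (volume : Measure ℝ))
      (f := a ∘ i.succAbove) (g := b ∘ i.succAbove)
    rw [← volume_pi] at hae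
    rw [← setIntegral_congr_set hae]
    refine (setIntegral_congr_fun (g := fun _ => c)
      (MeasurableSet.univ_pi fun _ => measurableSet_Ioo) h).trans ?_
    rw [setIntegral_const, smul_eq_mul, mul_comm, Measure.real,
      Real.volume_pi_Ioo_toReal fun j => hle _]
  have key := integral_divergence_of_hasFDerivAt_off_countable' a b hle
    (fun j => if j = i then g else 0) (fun j x => if j = i then fderiv ℝ g x else 0) ∅
    countable_empty ?_ ?_ ?_
  · simp only [hsum] at key
    rw [key, Finset.sum_eq_single i, if_pos rfl, hface _ _ ha, hface _ _ hb, sub_mul]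
    · intro j _ hj
      simp [hj]
    · simp
  · intro j
    split_ifs
    · exact hg.continuousOn.mono hab
    · exact continuousOn_const
  · rintro x ⟨hx, -⟩ j
    have hxU : x ∈ U := hab ⟨fun k => (hx k trivial).1.le, fun k => (hx k trivial).2.le⟩
    split_ifs
    · exact ((hg.differentiableOn one_ne_zero).differentiableAt (hU.mem_nhds hxU)).hasFDerivAt
    · exact hasFDerivAt_const 0 x
  · simp only [hsum]
    exact hderiv.integrableOn_compact isCompact_Icc

/-- The box as a product of open intervals. -/
theorem box_eq_pi (l₁ l₂ d : ℝ) :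
    box l₁ l₂ d = pi univ fun j => Ioo ((0 : Fin 3 → ℝ) j) (![l₁, l₂, d] j) := by
  ext x
  simp [box, Fin.forall_fin_succ]

/-- Order-reconstruction lower bound: a `C¹` unit vector field on a neighborhood of the
closure of `Ω = (0,l₁)×(0,l₂)×(0,d)` equal to `e₁` on the bottom plate and to `e₃` on the
top plate has Dirichlet energy at least `2l₁l₂/d`. -/
theorem order_reconstruction_lower_bound (l₁ l₂ d : ℝ)
    (hl₁ : 0 < l₁) (hl₂ : 0 < l₂) (hd : 0 < d)
    (U : Set (Fin 3 → ℝ)) (hU : IsOpen U) (hcl : closure (box l₁ l₂ d) ⊆ U)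
    (n : (Fin 3 → ℝ) → Fin 3 → ℝ) (hn : ContDiffOn ℝ 1 n U)
    (hunit : ∀ x ∈ U, ∑ i, n x i ^ 2 = 1)
    (hbot : ∀ x₁ ∈ Ioo (0:ℝ) l₁, ∀ x₂ ∈ Ioo (0:ℝ) l₂, n ![x₁, x₂, 0] = ![1, 0, 0])
    (htop : ∀ x₁ ∈ Ioo (0:ℝ) l₁, ∀ x₂ ∈ Ioo (0:ℝ) l₂, n ![x₁, x₂, d] = ![0, 0, 1]) :
    2 * l₁ * l₂ / d ≤ ∫ x in box l₁ l₂ d, gradNormSq n x := by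
  have hle : (0 : Fin 3 → ℝ) ≤ ![l₁, l₂, d] := by
    intro j
    fin_cases j <;> simp [hl₁.le, hl₂.le, hd.le]
  have hIcc : Icc 0 ![l₁, l₂, d] ⊆ U := by
    refine Subset.trans (Eq.subset ?_) hcl
    rw [box_eq_pi, closure_pi_set, ← pi_univ_Icc]
    congr 1
    ext1 j
    fin_cases j <;> simp [closure_Ioo, hl₁.ne, hl₂.ne, hd.ne]
  have hae : box l₁ l₂ d =ᵐ[volume] Icc 0 ![l₁, l₂, d] := by
    rw [box_eq_pi, volume_pi]
    exact Measure.univ_pi_Ioo_ae_eq_Icc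
  have hcomp : ∀ i, ContDiffOn ℝ 1 (fun y => n y i) U := contDiffOn_pi.1 hn
  have hcont : ∀ i j,
      ContinuousOn (fun x => fderiv ℝ (fun y => n y i) x (Pi.single j 1))
        (Icc 0 ![l₁, l₂, d]) := fun i j =>
    (((hcomp i).continuousOn_fderiv_of_isOpen hU le_rfl).clm_apply continuousOn_const).mono hIcc
  have hint : ∀ i j,
      IntegrableOn (fun x => fderiv ℝ (fun y => n y i) x (Pi.single j 1))
        (Icc 0 ![l₁, l₂, d]) := fun i j =>
    (hcont i j).integrableOn_compact isCompact_Icc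
  have hgrad : IntegrableOn (gradNormSq n) (Icc 0 ![l₁, l₂, d]) := by
    refine ContinuousOn.integrableOn_compact isCompact_Icc ?_
    exact continuousOn_finsetSum _ fun i _ => continuousOn_finsetSum _ fun j _ =>
      (hcont i j).pow 2
  have hinsert : ∀ (t : ℝ) (y : Fin 2 → ℝ),
      (2 : Fin 3).insertNth (α := fun _ => ℝ) t y = ![y 0, y 1, t] := by
    intro t y
    ext j
    fin_cases j <;> rfl
  have hval : ∀ i, ∫ x in Icc 0 ![l₁, l₂, d], fderiv ℝ (fun y => n y i) x (Pi.single 2 1) =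
      ((![0, 0, 1] : Fin 3 → ℝ) i - (![1, 0, 0] : Fin 3 → ℝ) i) * (l₁ * l₂) := by
    intro i
    rw [integral_fderiv_single_of_const_on_faces hle 2 hU hIcc (hcomp i)
      ((![1, 0, 0] : Fin 3 → ℝ) i) ((![0, 0, 1] : Fin 3 → ℝ) i)]
    · rw [Fin.prod_univ_two, show (2 : Fin 3).succAbove 0 = 0 from rfl,
        show (2 : Fin 3).succAbove 1 = 1 from rfl]
      simp
    · intro y hy
      exact congrFun ((congrArg n (hinsert _ y)).trans
        (hbot _ (hy 0 trivial) _ (hy 1 trivial))) i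
    · intro y hy
      exact congrFun ((congrArg n (hinsert _ y)).trans
        (htop _ (hy 0 trivial) _ (hy 1 trivial))) i
  have hvol : ∫ _ in Icc 0 ![l₁, l₂, d], (2 / d ^ 2 : ℝ) = 2 / d ^ 2 * (l₁ * l₂ * d) := by
    rw [setIntegral_const, smul_eq_mul, mul_comm, Measure.real, Real.volume_Icc_pi_toReal hle]
    simp [Fin.prod_univ_three]
  have hpt : ∀ x, 2 / d * (fderiv ℝ (fun y => n y 2) x (Pi.single 2 1) -
      fderiv ℝ (fun y => n y 0) x (Pi.single 2 1)) - 2 / d ^ 2 ≤ gradNormSq n x := by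
    intro x
    have hsq : ∀ p q : ℝ, 2 / d * (p - q) - 2 / d ^ 2 ≤ q ^ 2 + p ^ 2 := by
      intro p q
      have : q ^ 2 + p ^ 2 - (2 / d * (p - q) - 2 / d ^ 2) =
          (p - 1 / d) ^ 2 + (q + 1 / d) ^ 2 := by ring
      nlinarith [sq_nonneg (p - 1 / d), sq_nonneg (q + 1 / d)]
    refine (hsq _ _).trans ?_
    simp only [gradNormSq, Fin.sum_univ_three]
    refine le_of_sub_nonneg ?_
    ring_nf
    positivity
  have hlin : IntegrableOn (fun x => 2 / d * (fderiv ℝ (fun y => n y 2) x (Pi.single 2 1) -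
      fderiv ℝ (fun y => n y 0) x (Pi.single 2 1))) (Icc 0 ![l₁, l₂, d]) :=
    ((hint 2 2).sub (hint 0 2)).const_mul _
  have hconst : IntegrableOn (fun _ => (2 / d ^ 2 : ℝ)) (Icc 0 ![l₁, l₂, d]) :=
    continuousOn_const.integrableOn_compact isCompact_Icc
  calc 2 * l₁ * l₂ / d
      = ∫ x in Icc 0 ![l₁, l₂, d], (2 / d * (fderiv ℝ (fun y => n y 2) x (Pi.single 2 1) -
          fderiv ℝ (fun y => n y 0) x (Pi.single 2 1)) - 2 / d ^ 2) := by
        rw [integral_sub hlin hconst, integral_const_mul, integral_sub (hint 2 2) (hint 0 2),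
          hval, hval, hvol]
        simp
        field_simp
        ring
    _ ≤ ∫ x in Icc 0 ![l₁, l₂, d], gradNormSq n x :=
        integral_mono (Integrable.sub hlin hconst) hgrad hpt
    _ = ∫ x in box l₁ l₂ d, gradNormSq n x := (setIntegral_congr_set hae).symm
end
end

section
/- Let b > 0, c > 0 and a < b²/(27c), and define ψ_B on the set of real symmetric traceless 3×3 matrices by ψ_B(Q) = a tr(Q²) − (2b/3) tr(Q³) + c tr(Q⁴). Let s = (b + √(b² − 24ac))/(4c) > 0. Then ψ_B attains its minimum over symmetric traceless matrices exactly at the uniaxial matrices: ψ_B(Q) ≥ ψ_B(s(e⊗e − (1/3)I)) for every symmetric traceless Q and every unit vector e ∈ ℝ³ (the right-hand side being independent of e), with equality if and only if Q = s(n⊗n − (1/3)I) for some unit vector n ∈ S². -/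
open scoped BigOperators
open Matrix

noncomputable section

/-- The quartic Landau - de Gennes bulk potential
`ψ_B(Q) = a tr(Q²) − (2b/3) tr(Q³) + c tr(Q⁴)`. -/
def psiB (a b c : ℝ) (Q : Matrix (Fin 3) (Fin 3) ℝ) : ℝ :=
  a * (Q * Q).trace - (2 * b / 3) * (Q * Q * Q).trace + c * (Q * Q * Q * Q).trace

/-- The uniaxial matrix `s(e ⊗ e − (1/3)I)`. -/
def uniaxial (s : ℝ) (e : Fin 3 → ℝ) : Matrix (Fin 3) (Fin 3) ℝ :=
  s • (vecMulVec e e - (1/3 : ℝ) • 1)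

/-- The value of the quartic bulk potential on uniaxial matrices of scalar order parameter `t`. -/
def uniaxialEnergy (a b c t : ℝ) : ℝ :=
  2 * a / 3 * t ^ 2 - 4 * b / 27 * t ^ 3 + 2 * c / 9 * t ^ 4

theorem psiB_uniaxial (a b c s : ℝ) {e : Fin 3 → ℝ} (he : ∑ i, e i ^ 2 = 1) :
    psiB a b c (uniaxial s e) = uniaxialEnergy a b c s := by
  have hdot : e ⬝ᵥ e = 1 := by simpa [dotProduct, sq] using he
  have htr : (vecMulVec e e).trace = 1 := by rw [trace_vecMulVec, hdot]
  have hP : vecMulVec e e * vecMulVec e e = vecMulVec e e := by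
    rw [vecMulVec_mul_vecMulVec, hdot, one_smul]
  have h2 : uniaxial s e * uniaxial s e
      = (s ^ 2 / 3) • vecMulVec e e + (s ^ 2 / 9) • (1 : Matrix (Fin 3) (Fin 3) ℝ) := by
    simp only [uniaxial, smul_mul_assoc, mul_smul_comm, sub_mul, mul_sub, one_mul, mul_one, hP]
    module
  have h3 : uniaxial s e * uniaxial s e * uniaxial s e
      = (s ^ 3 / 3) • vecMulVec e e - (s ^ 3 / 27) • (1 : Matrix (Fin 3) (Fin 3) ℝ) := by
    rw [h2]
    simp only [uniaxial, smul_mul_assoc, mul_smul_comm, add_mul, mul_sub, one_mul, mul_one, hP]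
    module
  have h4 : uniaxial s e * uniaxial s e * uniaxial s e * uniaxial s e
      = (5 * s ^ 4 / 27) • vecMulVec e e + (s ^ 4 / 81) • (1 : Matrix (Fin 3) (Fin 3) ℝ) := by
    rw [h3]
    simp only [uniaxial, smul_mul_assoc, mul_smul_comm, sub_mul, mul_sub, one_mul, mul_one, hP]
    module
  rw [psiB, h4, h3, h2]
  simp only [trace_add, trace_sub, trace_smul, htr, trace_one, Fintype.card_fin, smul_eq_mul,
    uniaxialEnergy]
  push_cast
  ring

theorem uniaxialEnergy_sub (a b c s t : ℝ) (hs : 2 * c * s ^ 2 - b * s + 3 * a = 0) :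
    uniaxialEnergy a b c t - uniaxialEnergy a b c s
      = 2 / 27 * (t - s) ^ 2 * (3 * c * t ^ 2 + 2 * (3 * c * s - b) * t + s * (3 * c * s - b)) := by
  simp only [uniaxialEnergy]
  linear_combination (2 / 9 * (t ^ 2 - s ^ 2)) * hs

theorem uniaxialEnergy_le {a b c s t : ℝ} (hc : 0 < c) (hs : 2 * c * s ^ 2 - b * s + 3 * a = 0)
    (hs0 : 0 < s) (hbs : b < 3 * c * s) (ht : 0 ≤ t) :
    uniaxialEnergy a b c s ≤ uniaxialEnergy a b c t := by
  have hd : 0 < 3 * c * s - b := sub_pos.2 hbs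
  rw [← sub_nonneg, uniaxialEnergy_sub a b c s t hs]
  positivity

theorem eq_of_uniaxialEnergy_eq {a b c s t : ℝ} (hc : 0 < c)
    (hs : 2 * c * s ^ 2 - b * s + 3 * a = 0) (hs0 : 0 < s) (hbs : b < 3 * c * s) (ht : 0 ≤ t)
    (h : uniaxialEnergy a b c t = uniaxialEnergy a b c s) : t = s := by
  have hd : 0 < 3 * c * s - b := sub_pos.2 hbs
  have hpos : 0 < 3 * c * t ^ 2 + 2 * (3 * c * s - b) * t + s * (3 * c * s - b) := by positivity
  have key := uniaxialEnergy_sub a b c s t hs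
  rw [h, sub_self, eq_comm, mul_eq_zero, or_iff_left hpos.ne', mul_eq_zero,
    or_iff_right (by norm_num), sq_eq_zero_iff, sub_eq_zero] at key
  exact key

theorem three_mul_le_two_mul_of_sum_sq {x y z t : ℝ} (h : x + y + z = 0) (ht : 0 ≤ t)
    (hsq : 2 * t ^ 2 = 3 * (x ^ 2 + y ^ 2 + z ^ 2)) : 3 * x ≤ 2 * t := by
  refine le_of_sq_le_sq ?_ (by positivity)
  have hx : x = -(y + z) := by linarith
  subst hx
  nlinarith [sq_nonneg (y - z)]

theorem psiB_diagonal (a b c t : ℝ) {d : Fin 3 → ℝ} (h : d 0 + d 1 + d 2 = 0)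
    (hsq : 2 * t ^ 2 = 3 * (d 0 ^ 2 + d 1 ^ 2 + d 2 ^ 2)) :
    psiB a b c (diagonal d) = uniaxialEnergy a b c t
      + 2 * b / 27 * ((2 * t - 3 * d 0) * (2 * t - 3 * d 1) * (2 * t - 3 * d 2)) := by
  have hz : d 2 = -(d 0 + d 1) := by linarith
  have ht : t ^ 2 = 3 * (d 0 ^ 2 + d 0 * d 1 + d 1 ^ 2) := by rw [hz] at hsq; linarith
  have ht3 : t ^ 3 = 3 * (d 0 ^ 2 + d 0 * d 1 + d 1 ^ 2) * t := by rw [pow_succ, ht]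
  have ht4 : t ^ 4 = (3 * (d 0 ^ 2 + d 0 * d 1 + d 1 ^ 2)) ^ 2 := by rw [← ht]; ring
  simp only [psiB, diagonal_mul_diagonal, trace_diagonal, Fin.sum_univ_three, uniaxialEnergy, hz]
  ring_nf
  rw [ht3, ht4, ht]
  ring

theorem eq_of_three_mul_eq_two_mul {x y z t : ℝ} (h : x + y + z = 0)
    (hsq : 2 * t ^ 2 = 3 * (x ^ 2 + y ^ 2 + z ^ 2)) (hx : 2 * t - 3 * x = 0) :
    x = t * (1 - 1 / 3) ∧ y = t * (0 - 1 / 3) ∧ z = t * (0 - 1 / 3) := by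
  have hyz : y = z := by
    obtain rfl : t = 3 / 2 * x := by linarith
    obtain rfl : x = -(y + z) := by linarith
    have : (y - z) ^ 2 = 0 := by linarith
    exact sub_eq_zero.1 (pow_eq_zero_iff two_ne_zero |>.1 this)
  refine ⟨?_, ?_, ?_⟩ <;> linarith

theorem exists_diagonal_eq_uniaxial {d : Fin 3 → ℝ} {t : ℝ} (h : d 0 + d 1 + d 2 = 0)
    (hsq : 2 * t ^ 2 = 3 * (d 0 ^ 2 + d 1 ^ 2 + d 2 ^ 2))
    (hprod : (2 * t - 3 * d 0) * (2 * t - 3 * d 1) * (2 * t - 3 * d 2) = 0) :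
    ∃ n : Fin 3 → ℝ, n ⬝ᵥ n = 1 ∧ diagonal d = uniaxial t n := by
  have key : ∃ k, ∀ i, d i = t * ((if i = k then 1 else 0) - 1 / 3) := by
    rcases mul_eq_zero.1 hprod with h01 | h2
    · rcases mul_eq_zero.1 h01 with h0 | h1
      · obtain ⟨e0, e1, e2⟩ := eq_of_three_mul_eq_two_mul h hsq h0
        exact ⟨0, fun i => by fin_cases i <;> simp [*]⟩
      · obtain ⟨e1, e2, e0⟩ := eq_of_three_mul_eq_two_mul (x := d 1) (y := d 2) (z := d 0)
          (by linarith) (by linarith) h1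
        exact ⟨1, fun i => by fin_cases i <;> simp [*]⟩
    · obtain ⟨e2, e0, e1⟩ := eq_of_three_mul_eq_two_mul (x := d 2) (y := d 0) (z := d 1)
        (by linarith) (by linarith) h2
      exact ⟨2, fun i => by fin_cases i <;> simp [*]⟩
  obtain ⟨k, hk⟩ := key
  refine ⟨Pi.single k 1, by simp, ?_⟩
  ext i j
  rcases eq_or_ne i j with rfl | hij
  · simp [uniaxial, vecMulVec_apply, hk, Pi.single_apply]
  · simp only [uniaxial, diagonal_apply_ne _ hij, Matrix.smul_apply, Matrix.sub_apply,
      vecMulVec_apply, one_apply_ne hij, Pi.single_apply]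
    split_ifs <;> simp_all

theorem Matrix.IsSymm.exists_orthogonal_diagonal {Q : Matrix (Fin 3) (Fin 3) ℝ} (hQ : Q.IsSymm) :
    ∃ (U : Matrix (Fin 3) (Fin 3) ℝ) (d : Fin 3 → ℝ), Uᵀ * U = 1 ∧ U * Uᵀ = 1 ∧
      Q = U * diagonal d * Uᵀ := by
  have hH : Q.IsHermitian := by rw [Matrix.IsHermitian, conjTranspose_eq_transpose_of_trivial, hQ]
  refine ⟨hH.eigenvectorUnitary, hH.eigenvalues, ?_, ?_, ?_⟩
  · simpa [star_eq_conjTranspose] using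
      Unitary.coe_star_mul_self hH.eigenvectorUnitary
  · simpa [star_eq_conjTranspose] using
      Unitary.coe_mul_star_self hH.eigenvectorUnitary
  · simpa [Unitary.conjStarAlgAut_apply, star_eq_conjTranspose, Function.comp_def] using
      hH.spectral_theorem

theorem psiB_conj (a b c : ℝ) {U : Matrix (Fin 3) (Fin 3) ℝ} (hU : Uᵀ * U = 1)
    (D : Matrix (Fin 3) (Fin 3) ℝ) : psiB a b c (U * D * Uᵀ) = psiB a b c D := by
  have hmul (A B : Matrix (Fin 3) (Fin 3) ℝ) : U * A * Uᵀ * (U * B * Uᵀ) = U * (A * B) * Uᵀ := by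
    calc U * A * Uᵀ * (U * B * Uᵀ) = U * A * (Uᵀ * U) * B * Uᵀ := by simp only [Matrix.mul_assoc]
      _ = U * (A * B) * Uᵀ := by rw [hU, Matrix.mul_one, Matrix.mul_assoc U A B]
  have htr (A : Matrix (Fin 3) (Fin 3) ℝ) : (U * A * Uᵀ).trace = A.trace := by
    rw [trace_mul_comm, ← Matrix.mul_assoc, hU, Matrix.one_mul]
  simp only [psiB, hmul, htr]

theorem conj_uniaxial (s : ℝ) {U : Matrix (Fin 3) (Fin 3) ℝ} (hU : U * Uᵀ = 1) (n : Fin 3 → ℝ) :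
    U * uniaxial s n * Uᵀ = uniaxial s (U *ᵥ n) := by
  simp only [uniaxial, mul_smul_comm, smul_mul_assoc, mul_sub, sub_mul, mul_one, hU,
    mul_vecMulVec, vecMulVec_mul, vecMul_transpose]

/-- The bulk energy of a symmetric traceless `Q` is at least that of a uniaxial matrix with the
same `tr(Q²)`, with equality only if `Q` is itself uniaxial with that order parameter. -/
theorem exists_uniaxialEnergy_le_psiB (a c : ℝ) {b : ℝ} (hb : 0 < b)
    {Q : Matrix (Fin 3) (Fin 3) ℝ} (hQ : Q.IsSymm) (htr : Q.trace = 0) :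
    ∃ t, 0 ≤ t ∧ uniaxialEnergy a b c t ≤ psiB a b c Q ∧
      (psiB a b c Q = uniaxialEnergy a b c t →
        ∃ n : Fin 3 → ℝ, (∑ i, n i ^ 2 = 1) ∧ Q = uniaxial t n) := by
  obtain ⟨U, d, hU, hU', rfl⟩ := hQ.exists_orthogonal_diagonal
  have h : d 0 + d 1 + d 2 = 0 := by
    rwa [trace_mul_comm, ← Matrix.mul_assoc, hU, Matrix.one_mul, trace_diagonal,
      Fin.sum_univ_three] at htr
  set t := Real.sqrt (3 / 2 * (d 0 ^ 2 + d 1 ^ 2 + d 2 ^ 2)) with ht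
  have ht0 : 0 ≤ t := Real.sqrt_nonneg _
  have hsq : 2 * t ^ 2 = 3 * (d 0 ^ 2 + d 1 ^ 2 + d 2 ^ 2) := by
    rw [ht, Real.sq_sqrt (by positivity)]
    ring
  have h0 : 0 ≤ 2 * t - 3 * d 0 := sub_nonneg.2 (three_mul_le_two_mul_of_sum_sq h ht0 hsq)
  have h1 : 0 ≤ 2 * t - 3 * d 1 := sub_nonneg.2 <|
    three_mul_le_two_mul_of_sum_sq (y := d 2) (z := d 0) (by linarith) ht0 (by linarith)
  have h2 : 0 ≤ 2 * t - 3 * d 2 := sub_nonneg.2 <|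
    three_mul_le_two_mul_of_sum_sq (y := d 0) (z := d 1) (by linarith) ht0 (by linarith)
  rw [psiB_conj a b c hU, psiB_diagonal a b c t h hsq]
  refine ⟨t, ht0, le_add_of_nonneg_right (by positivity), fun heq => ?_⟩
  rw [add_eq_left, mul_eq_zero, or_iff_right (by positivity)] at heq
  obtain ⟨n, hn, hd⟩ := exists_diagonal_eq_uniaxial h hsq heq
  refine ⟨U *ᵥ n, ?_, by rw [hd, conj_uniaxial t hU']⟩
  calc ∑ i, (U *ᵥ n) i ^ 2 = (U *ᵥ n) ⬝ᵥ (U *ᵥ n) := by simp only [dotProduct, sq]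
    _ = 1 := by rw [dotProduct_mulVec, vecMul_mulVec, hU, vecMul_one, hn]

/-- For `b, c > 0` and `a < b²/(27c)`, the quartic Landau - de Gennes bulk potential is
minimized over symmetric traceless `3×3` matrices exactly at the uniaxial matrices
`s(n ⊗ n − (1/3)I)` with `|n| = 1` and `s = (b + √(b² − 24ac))/(4c) > 0`. -/
theorem quartic_bulk_minimized_at_uniaxial (a b c : ℝ)
    (hb : 0 < b) (hc : 0 < c) (ha : a < b ^ 2 / (27 * c)) :
    0 < (b + Real.sqrt (b ^ 2 - 24 * a * c)) / (4 * c) ∧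
    ∀ Q : Matrix (Fin 3) (Fin 3) ℝ, Q.IsSymm → Q.trace = 0 →
      ∀ e : Fin 3 → ℝ, (∑ i, e i ^ 2 = 1) →
        psiB a b c Q ≥
            psiB a b c (uniaxial ((b + Real.sqrt (b ^ 2 - 24 * a * c)) / (4 * c)) e) ∧
        (psiB a b c Q =
            psiB a b c (uniaxial ((b + Real.sqrt (b ^ 2 - 24 * a * c)) / (4 * c)) e) ↔
          ∃ n : Fin 3 → ℝ, (∑ i, n i ^ 2 = 1) ∧
            Q = uniaxial ((b + Real.sqrt (b ^ 2 - 24 * a * c)) / (4 * c)) n) := by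
  set r := Real.sqrt (b ^ 2 - 24 * a * c)
  have hac : 27 * (a * c) < b ^ 2 := by
    rw [lt_div_iff₀ (by positivity)] at ha
    linarith
  have hr2 : r ^ 2 = b ^ 2 - 24 * a * c := Real.sq_sqrt (by nlinarith [sq_nonneg b])
  have hbr : b / 3 < r := Real.lt_sqrt_of_sq_lt (by linarith)
  set s := (b + r) / (4 * c) with hs
  have hcs : 4 * c * s = b + r := by rw [hs]; field_simp
  have hs0 : 0 < s := div_pos (by linarith) (by positivity)
  have hcrit : 2 * c * s ^ 2 - b * s + 3 * a = 0 := by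
    rw [hs]
    field_simp
    linear_combination 2 * hr2
  have hbs : b < 3 * c * s := by linarith
  refine ⟨hs0, fun Q hQ htr e he => ?_⟩
  obtain ⟨t, ht0, hle, heq⟩ := exists_uniaxialEnergy_le_psiB a c hb hQ htr
  have hst := uniaxialEnergy_le hc hcrit hs0 hbs ht0
  rw [psiB_uniaxial a b c s he]
  refine ⟨hst.trans hle, fun h => ?_, ?_⟩
  · obtain rfl : t = s := eq_of_uniaxialEnergy_eq hc hcrit hs0 hbs ht0 (by linarith)
    exact heq h
  · rintro ⟨n, hn, rfl⟩
    exact psiB_uniaxial a b c s hn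
end
end

section
/- Let Ω ⊂ ℝ³ be a nonempty bounded open set, let ψ_B be any continuous real-valued function on the space of real symmetric traceless 3×3 matrices, let L₁, L₂, L₃ ∈ ℝ and L₄ ≠ 0, and let Q̄ : ℝ³ → M₃(ℝ) be any smooth map taking values in symmetric traceless matrices. Define, for smooth symmetric-traceless-valued Q, the energy I(Q) = ∫_Ω ( ψ_B(Q) + L₁ I₁ + L₂ I₂ + L₃ I₃ + L₄ I₄ ) dx, where I₁ = Q_{ij,k}Q_{ij,k}, I₂ = Q_{ij,j}Q_{ik,k}, I₃ = Q_{ik,j}Q_{ij,k}, I₄ = Q_{lk}Q_{ij,l}Q_{ij,k} (repeated indices summed). Then I is unbounded below on the class of boundary-compatible fields: for every C ∈ ℝ there exists a smooth map Q : ℝ³ → M₃(ℝ) with values in symmetric traceless matrices, agreeing with Q̄ outside a compact subset of Ω, such that I(Q) < C. -/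
open scoped BigOperators
open MeasureTheory

noncomputable section

/-- The partial derivative `Q_{ij,k} = ∂Q_{ij}/∂x_k` of a matrix-valued field. -/
def pQ (Q : (Fin 3 → ℝ) → Fin 3 → Fin 3 → ℝ) (x : Fin 3 → ℝ) (i j k : Fin 3) : ℝ :=
  fderiv ℝ (fun y => Q y i j) x (Pi.single k 1)

/-- The elastic invariant `I₁ = Q_{ij,k}Q_{ij,k}`. -/
def elastI1 (Q : (Fin 3 → ℝ) → Fin 3 → Fin 3 → ℝ) (x : Fin 3 → ℝ) : ℝ :=
  ∑ i, ∑ j, ∑ k, pQ Q x i j k ^ 2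

/-- The elastic invariant `I₂ = Q_{ij,j}Q_{ik,k}`. -/
def elastI2 (Q : (Fin 3 → ℝ) → Fin 3 → Fin 3 → ℝ) (x : Fin 3 → ℝ) : ℝ :=
  ∑ i, (∑ j, pQ Q x i j j) * (∑ k, pQ Q x i k k)

/-- The elastic invariant `I₃ = Q_{ik,j}Q_{ij,k}`. -/
def elastI3 (Q : (Fin 3 → ℝ) → Fin 3 → Fin 3 → ℝ) (x : Fin 3 → ℝ) : ℝ :=
  ∑ i, ∑ j, ∑ k, pQ Q x i k j * pQ Q x i j k

/-- The cubic elastic invariant `I₄ = Q_{lk}Q_{ij,l}Q_{ij,k}`. -/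
def elastI4 (Q : (Fin 3 → ℝ) → Fin 3 → Fin 3 → ℝ) (x : Fin 3 → ℝ) : ℝ :=
  ∑ l, ∑ k, ∑ i, ∑ j, Q x l k * pQ Q x i j l * pQ Q x i j k

/-- The elastic energy density as a function of the value `q` and the gradient `G`. -/
def elasticDensity (L₁ L₂ L₃ L₄ : ℝ) (q : Fin 3 → Fin 3 → ℝ)
    (G : Fin 3 → Fin 3 → Fin 3 → ℝ) : ℝ :=
  L₁ * (∑ i, ∑ j, ∑ k, G i j k ^ 2) + L₂ * (∑ i, (∑ j, G i j j) * (∑ k, G i k k)) +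
    L₃ * (∑ i, ∑ j, ∑ k, G i k j * G i j k) +
    L₄ * (∑ l, ∑ k, ∑ i, ∑ j, q l k * G i j l * G i j k)

lemma elasticDensity_smul (L₁ L₂ L₃ L₄ a : ℝ) (q : Fin 3 → Fin 3 → ℝ)
    (G : Fin 3 → Fin 3 → Fin 3 → ℝ) :
    elasticDensity L₁ L₂ L₃ L₄ q (fun i j k => a * G i j k) =
      a ^ 2 * elasticDensity L₁ L₂ L₃ L₄ q G := by
  have h₁ : ∑ i, ∑ j, ∑ k, (a * G i j k) ^ 2 = a ^ 2 * ∑ i, ∑ j, ∑ k, G i j k ^ 2 := by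
    simp only [Finset.mul_sum, mul_pow]
  have h₂ : ∑ i, (∑ j, a * G i j j) * (∑ k, a * G i k k) =
      a ^ 2 * ∑ i, (∑ j, G i j j) * (∑ k, G i k k) := by
    simp only [← Finset.mul_sum]
    rw [Finset.mul_sum]
    exact Finset.sum_congr rfl fun i _ => by ring
  have h₃ : ∑ i, ∑ j, ∑ k, (a * G i k j) * (a * G i j k) =
      a ^ 2 * ∑ i, ∑ j, ∑ k, G i k j * G i j k := by
    simp only [Finset.mul_sum]
    refine Finset.sum_congr rfl fun i _ => Finset.sum_congr rfl fun j _ =>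
      Finset.sum_congr rfl fun k _ => by ring
  have h₄ : ∑ l, ∑ k, ∑ i, ∑ j, q l k * (a * G i j l) * (a * G i j k) =
      a ^ 2 * ∑ l, ∑ k, ∑ i, ∑ j, q l k * G i j l * G i j k := by
    simp only [Finset.mul_sum]
    refine Finset.sum_congr rfl fun l _ => Finset.sum_congr rfl fun k _ =>
      Finset.sum_congr rfl fun i _ => Finset.sum_congr rfl fun j _ => by ring
  unfold elasticDensity
  rw [h₁, h₂, h₃, h₄]
  ring

lemma continuous_elasticDensity {X : Type*} [TopologicalSpace X] (L₁ L₂ L₃ L₄ : ℝ)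
    {q : X → Fin 3 → Fin 3 → ℝ} {G : X → Fin 3 → Fin 3 → Fin 3 → ℝ}
    (hq : ∀ i j, Continuous fun x => q x i j)
    (hG : ∀ i j k, Continuous fun x => G x i j k) :
    Continuous fun x => elasticDensity L₁ L₂ L₃ L₄ (q x) (G x) := by
  unfold elasticDensity
  fun_prop

/-- A planar matrix field on the `(e₂, e₃)` block, indexed by a complex number. -/
def planarMatrix (z : ℂ) : Fin 3 → Fin 3 → ℝ :=
  ![![0, 0, 0], ![0, z.im, z.re], ![0, z.re, -z.im]]

/-- For a gradient in the direction `e₁` of a field rotating in the `(e₂, e₃)` block, only the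
invariants `I₁` and `I₄` survive. -/
lemma elasticDensity_planar (L₁ L₂ L₃ L₄ a : ℝ) (q : Fin 3 → Fin 3 → ℝ) (z : ℂ) :
    elasticDensity L₁ L₂ L₃ L₄ q
        (fun i j k => a * planarMatrix z i j * (Pi.single k 1 : Fin 3 → ℝ) 0) =
      2 * a ^ 2 * (z.re ^ 2 + z.im ^ 2) * (L₁ + L₄ * q 0 0) := by
  simp [elasticDensity, planarMatrix, Fin.sum_univ_three, Pi.single_apply]
  ring

lemma continuous_planarMatrix (i j : Fin 3) : Continuous fun z => planarMatrix z i j := by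
  fin_cases i <;> fin_cases j <;> simp [planarMatrix] <;> fun_prop

lemma continuous_pQ {P : (Fin 3 → ℝ) → Fin 3 → Fin 3 → ℝ} (hP : ContDiff ℝ (⊤ : ℕ∞) P)
    (i j k : Fin 3) : Continuous fun x => pQ P x i j k := by
  have h : ContDiff ℝ (⊤ : ℕ∞) fun x => P x i j := contDiff_pi.1 (contDiff_pi.1 hP i) j
  exact (h.continuous_fderiv (by simp)).clm_apply continuous_const

/-- The point of the unit circle with angle `t`. -/
def circlePoint (t : ℝ) : ℂ := ⟨Real.cos t, Real.sin t⟩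

lemma contDiff_planarMatrix_circlePoint (N : ℝ) (i j : Fin 3) :
    ContDiff ℝ (⊤ : ℕ∞) fun x : Fin 3 → ℝ => planarMatrix (circlePoint (N * x 0)) i j := by
  fin_cases i <;> fin_cases j <;> simp [planarMatrix, circlePoint] <;> fun_prop

lemma hasFDerivAt_planarMatrix_circlePoint (N : ℝ) (x : Fin 3 → ℝ) (i j : Fin 3) :
    HasFDerivAt (fun y : Fin 3 → ℝ => planarMatrix (circlePoint (N * y 0)) i j)
      ((N * planarMatrix (Complex.I * circlePoint (N * x 0)) i j) •
        (ContinuousLinearMap.proj 0 : (Fin 3 → ℝ) →L[ℝ] ℝ)) x := by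
  have h0 : HasFDerivAt (fun y : Fin 3 → ℝ => N * y 0)
      (N • (ContinuousLinearMap.proj 0 : (Fin 3 → ℝ) →L[ℝ] ℝ)) x :=
    (ContinuousLinearMap.proj 0 : (Fin 3 → ℝ) →L[ℝ] ℝ).hasFDerivAt.const_mul N
  have hs := h0.sin
  have hc := h0.cos
  have hn := hs.neg
  have hz := hasFDerivAt_const (𝕜 := ℝ) (0 : ℝ) x
  simp only [smul_smul, ← neg_smul, mul_comm _ N, mul_neg] at hs hc hn
  fin_cases i <;> fin_cases j <;> simp [planarMatrix, circlePoint] <;>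
    first
      | exact hz
      | exact hs
      | exact hc
      | exact hn

/-- Adding a helical perturbation of amplitude `φ` and frequency `N` to a smooth field `P`. -/
def helix (P : (Fin 3 → ℝ) → Fin 3 → Fin 3 → ℝ) (φ : (Fin 3 → ℝ) → ℝ) (N : ℝ) :
    (Fin 3 → ℝ) → Fin 3 → Fin 3 → ℝ :=
  fun x i j => P x i j + φ x * planarMatrix (circlePoint (N * x 0)) i j

lemma contDiff_helix {P : (Fin 3 → ℝ) → Fin 3 → Fin 3 → ℝ} {φ : (Fin 3 → ℝ) → ℝ}
    (hP : ContDiff ℝ (⊤ : ℕ∞) P) (hφ : ContDiff ℝ (⊤ : ℕ∞) φ) (N : ℝ) :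
    ContDiff ℝ (⊤ : ℕ∞) (helix P φ N) := by
  refine contDiff_pi.2 fun i => contDiff_pi.2 fun j => ?_
  exact (contDiff_pi.1 (contDiff_pi.1 hP i) j).add
    (hφ.mul (contDiff_planarMatrix_circlePoint N i j))

lemma pQ_helix {P : (Fin 3 → ℝ) → Fin 3 → Fin 3 → ℝ} {φ : (Fin 3 → ℝ) → ℝ}
    (hP : ContDiff ℝ (⊤ : ℕ∞) P) (hφ : ContDiff ℝ (⊤ : ℕ∞) φ) (N : ℝ) (x : Fin 3 → ℝ)
    (i j k : Fin 3) :
    pQ (helix P φ N) x i j k =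
      pQ P x i j k +
        fderiv ℝ φ x (Pi.single k 1) * planarMatrix (circlePoint (N * x 0)) i j +
        N * (φ x * planarMatrix (Complex.I * circlePoint (N * x 0)) i j *
          (Pi.single k 1 : Fin 3 → ℝ) 0) := by
  have h : ContDiff ℝ (⊤ : ℕ∞) fun x => P x i j := contDiff_pi.1 (contDiff_pi.1 hP i) j
  have h1 := (h.differentiable (by simp) x).hasFDerivAt
  have h2 := (hφ.differentiable (by simp) x).hasFDerivAt
  have h3 := h1.add (h2.mul (hasFDerivAt_planarMatrix_circlePoint N x i j))
  unfold pQ helix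
  erw [h3.fderiv]
  simp
  ring

/-- The energy density of a helical perturbation, rescaled by `ε² = N⁻²`, as a function of the
position `x`, the phase `z` on the unit circle and `ε`. -/
def rescaledDensity (ψ : (Fin 3 → Fin 3 → ℝ) → ℝ) (L₁ L₂ L₃ L₄ : ℝ)
    (P : (Fin 3 → ℝ) → Fin 3 → Fin 3 → ℝ) (φ : (Fin 3 → ℝ) → ℝ)
    (p : (Fin 3 → ℝ) × ℂ) (ε : ℝ) : ℝ :=
  ε ^ 2 * ψ (fun i j => P p.1 i j + φ p.1 * planarMatrix p.2 i j) +
    elasticDensity L₁ L₂ L₃ L₄ (fun i j => P p.1 i j + φ p.1 * planarMatrix p.2 i j)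
      (fun i j k => ε * (pQ P p.1 i j k +
          fderiv ℝ φ p.1 (Pi.single k 1) * planarMatrix p.2 i j) +
        φ p.1 * planarMatrix (Complex.I * p.2) i j * (Pi.single k 1 : Fin 3 → ℝ) 0)

lemma continuous_rescaledDensity {ψ : (Fin 3 → Fin 3 → ℝ) → ℝ} (hψ : Continuous ψ)
    (L₁ L₂ L₃ L₄ : ℝ) {P : (Fin 3 → ℝ) → Fin 3 → Fin 3 → ℝ} {φ : (Fin 3 → ℝ) → ℝ}
    (hP : ContDiff ℝ (⊤ : ℕ∞) P) (hφ : ContDiff ℝ (⊤ : ℕ∞) φ) :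
    Continuous fun y : ((Fin 3 → ℝ) × ℂ) × ℝ =>
      rescaledDensity ψ L₁ L₂ L₃ L₄ P φ y.1 y.2 := by
  have hPc (i j : Fin 3) : Continuous fun x => P x i j :=
    (contDiff_pi.1 (contDiff_pi.1 hP i) j).continuous
  have hφc := hφ.continuous
  have hM := continuous_planarMatrix
  have hdP := continuous_pQ hP
  have hdφ (k : Fin 3) : Continuous fun x => fderiv ℝ φ x (Pi.single k 1) :=
    (hφ.continuous_fderiv (by simp)).clm_apply continuous_const
  have hM1 (i j : Fin 3) :
      Continuous fun y : ((Fin 3 → ℝ) × ℂ) × ℝ => planarMatrix y.1.2 i j :=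
    (hM i j).comp (by fun_prop)
  have hM2 (i j : Fin 3) :
      Continuous fun y : ((Fin 3 → ℝ) × ℂ) × ℝ => planarMatrix (Complex.I * y.1.2) i j :=
    (hM i j).comp (g := fun z => planarMatrix z i j)
      (f := fun y : ((Fin 3 → ℝ) × ℂ) × ℝ => Complex.I * y.1.2) (by fun_prop)
  have hP1 (i j : Fin 3) : Continuous fun y : ((Fin 3 → ℝ) × ℂ) × ℝ => P y.1.1 i j :=
    (hPc i j).comp (by fun_prop)
  have hφ1 : Continuous fun y : ((Fin 3 → ℝ) × ℂ) × ℝ => φ y.1.1 := by fun_prop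
  have hdP1 (i j k : Fin 3) :
      Continuous fun y : ((Fin 3 → ℝ) × ℂ) × ℝ => pQ P y.1.1 i j k :=
    (hdP i j k).comp (g := fun x => pQ P x i j k)
      (f := fun y : ((Fin 3 → ℝ) × ℂ) × ℝ => y.1.1) (by fun_prop)
  have hdφ1 (k : Fin 3) :
      Continuous fun y : ((Fin 3 → ℝ) × ℂ) × ℝ => fderiv ℝ φ y.1.1 (Pi.single k 1) :=
    (hdφ k).comp (g := fun x => fderiv ℝ φ x (Pi.single k 1))
      (f := fun y : ((Fin 3 → ℝ) × ℂ) × ℝ => y.1.1) (by fun_prop)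
  have hq (i j : Fin 3) : Continuous fun y : ((Fin 3 → ℝ) × ℂ) × ℝ =>
      P y.1.1 i j + φ y.1.1 * planarMatrix y.1.2 i j := (hP1 i j).add (hφ1.mul (hM1 i j))
  unfold rescaledDensity
  refine Continuous.add ?_ (continuous_elasticDensity _ _ _ _ hq fun i j k => ?_)
  · exact (continuous_snd.pow 2).mul
      (hψ.comp (continuous_pi fun i => continuous_pi fun j => hq i j))
  · exact (continuous_snd.mul ((hdP1 i j k).add ((hdφ1 k).mul (hM1 i j)))).add
      ((hφ1.mul (hM2 i j)).mul continuous_const)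

lemma density_helix_eq {ψ : (Fin 3 → Fin 3 → ℝ) → ℝ}
    (L₁ L₂ L₃ L₄ : ℝ) {P : (Fin 3 → ℝ) → Fin 3 → Fin 3 → ℝ} {φ : (Fin 3 → ℝ) → ℝ}
    (hP : ContDiff ℝ (⊤ : ℕ∞) P) (hφ : ContDiff ℝ (⊤ : ℕ∞) φ) {N : ℝ} (hN : N ≠ 0)
    (x : Fin 3 → ℝ) :
    ψ (helix P φ N x) + L₁ * elastI1 (helix P φ N) x + L₂ * elastI2 (helix P φ N) x +
        L₃ * elastI3 (helix P φ N) x + L₄ * elastI4 (helix P φ N) x =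
      N ^ 2 * rescaledDensity ψ L₁ L₂ L₃ L₄ P φ (x, circlePoint (N * x 0)) N⁻¹ := by
  have h : ψ (helix P φ N x) + L₁ * elastI1 (helix P φ N) x + L₂ * elastI2 (helix P φ N) x +
        L₃ * elastI3 (helix P φ N) x + L₄ * elastI4 (helix P φ N) x =
      ψ (helix P φ N x) + elasticDensity L₁ L₂ L₃ L₄ (helix P φ N x)
        (fun i j k => pQ (helix P φ N) x i j k) := by
    unfold elasticDensity elastI1 elastI2 elastI3 elastI4
    ring
  rw [h, rescaledDensity, mul_add, ← elasticDensity_smul, ← mul_assoc]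
  congr 1
  · rw [← mul_pow, mul_inv_cancel₀ hN, one_pow, one_mul]
    rfl
  · change elasticDensity L₁ L₂ L₃ L₄ (helix P φ N x) _ =
      elasticDensity L₁ L₂ L₃ L₄ (helix P φ N x) _
    congr 1
    funext i j k
    rw [pQ_helix hP hφ, mul_add, mul_inv_cancel_left₀ hN]

lemma rescaledDensity_zero (ψ : (Fin 3 → Fin 3 → ℝ) → ℝ) (L₁ L₂ L₃ L₄ : ℝ)
    (P : (Fin 3 → ℝ) → Fin 3 → Fin 3 → ℝ) (φ : (Fin 3 → ℝ) → ℝ)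
    (x : Fin 3 → ℝ) {z : ℂ} (hz : z.re ^ 2 + z.im ^ 2 = 1) :
    rescaledDensity ψ L₁ L₂ L₃ L₄ P φ (x, z) 0 =
      2 * φ x ^ 2 * (L₁ + L₄ * P x 0 0) := by
  have h : (Complex.I * z).re ^ 2 + (Complex.I * z).im ^ 2 = 1 := by
    simp; linarith
  simp only [rescaledDensity, zero_mul, zero_add, ne_eq, OfNat.ofNat_ne_zero, not_false_eq_true,
    zero_pow, elasticDensity_planar, h]
  simp [planarMatrix]

/-- If `L₁ + L₄ P₁₁ = -1` on the support of `φ`, then the energy of the helical perturbations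
with amplitude `φ` takes arbitrarily negative values as the frequency grows. -/
lemma exists_energy_helix_lt {Ω : Set (Fin 3 → ℝ)} (hΩo : IsOpen Ω)
    (hΩb : Bornology.IsBounded Ω) {ψ : (Fin 3 → Fin 3 → ℝ) → ℝ} (hψ : Continuous ψ)
    (L₁ L₂ L₃ L₄ : ℝ) {P : (Fin 3 → ℝ) → Fin 3 → Fin 3 → ℝ} {φ : (Fin 3 → ℝ) → ℝ}
    (hP : ContDiff ℝ (⊤ : ℕ∞) P) (hφ : ContDiff ℝ (⊤ : ℕ∞) φ)
    (hPφ : ∀ x, φ x ≠ 0 → L₁ + L₄ * P x 0 0 = -1) (hφΩ : 0 < ∫ x in Ω, φ x ^ 2) (C : ℝ) :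
    ∃ N : ℝ, (∫ x in Ω, (ψ (helix P φ N x) + L₁ * elastI1 (helix P φ N) x +
      L₂ * elastI2 (helix P φ N) x + L₃ * elastI3 (helix P φ N) x +
      L₄ * elastI4 (helix P φ N) x)) < C := by
  have hcpt : IsCompact (closure Ω) := hΩb.isCompact_closure
  have hint {f : (Fin 3 → ℝ) → ℝ} (hf : Continuous f) : IntegrableOn f Ω :=
    (hf.continuousOn.integrableOn_compact hcpt).mono_set subset_closure
  have hR := continuous_rescaledDensity hψ L₁ L₂ L₃ L₄ hP hφ
  set J := ∫ x in Ω, φ x ^ 2 with hJ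
  set V := volume.real Ω with hV
  have hV0 : 0 ≤ V := measureReal_nonneg
  obtain ⟨δ, hδ, hδV⟩ : ∃ δ : ℝ, 0 < δ ∧ δ * V ≤ J := by
    refine ⟨J / (V + 1), by positivity, ?_⟩
    rw [div_mul_eq_mul_div, div_le_iff₀ (by positivity)]
    nlinarith
  have hcirc : IsCompact (closure Ω ×ˢ Metric.sphere (0 : ℂ) 1) :=
    hcpt.prod (isCompact_sphere _ _)
  have hunif : ∀ᶠ ε in nhds (0 : ℝ), ∀ p ∈ closure Ω ×ˢ Metric.sphere (0 : ℂ) 1,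
      rescaledDensity ψ L₁ L₂ L₃ L₄ P φ p ε < -2 * φ p.1 ^ 2 + δ := by
    refine hcirc.eventually_forall_of_forall_eventually fun p hp => ?_
    have hlt : rescaledDensity ψ L₁ L₂ L₃ L₄ P φ p 0 < -2 * φ p.1 ^ 2 + δ := by
      have hz : p.2.re ^ 2 + p.2.im ^ 2 = 1 := by
        have h := hp.2
        rw [mem_sphere_zero_iff_norm] at h
        have h2 := Complex.sq_norm p.2
        rw [h, Complex.normSq_apply] at h2
        linarith
      rw [show p = (p.1, p.2) from rfl, rescaledDensity_zero _ _ _ _ _ _ _ _ hz]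
      by_cases h : φ p.1 = 0
      · simp [h, hδ]
      · rw [hPφ _ h]
        simp only
        linarith
    have hcφ := hφ.continuous
    exact (isOpen_lt (f := fun y : ℝ × (Fin 3 → ℝ) × ℂ =>
      rescaledDensity ψ L₁ L₂ L₃ L₄ P φ y.2 y.1) (g := fun y => -2 * φ y.2.1 ^ 2 + δ)
      (hR.comp continuous_swap) (by fun_prop)).mem_nhds (x := (0, p)) hlt
  have hbig : ∀ᶠ N : ℝ in Filter.atTop, -C < N ^ 2 * J :=
    ((Filter.tendsto_pow_atTop two_ne_zero).atTop_mul_const hφΩ).eventually_gt_atTop _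
  obtain ⟨N, hN, hNC, hN0⟩ := ((tendsto_inv_atTop_zero.eventually hunif).and
    (hbig.and (Filter.eventually_gt_atTop (0 : ℝ)))).exists
  refine ⟨N, ?_⟩
  have hcirc' (t : ℝ) : circlePoint t ∈ Metric.sphere (0 : ℂ) 1 := by
    rw [mem_sphere_zero_iff_norm, ← sq_eq_sq₀ (norm_nonneg _) zero_le_one, Complex.sq_norm,
      Complex.normSq_apply]
    simp only [circlePoint]
    linarith [Real.cos_sq_add_sin_sq t]
  have hcpc : Continuous fun x : Fin 3 → ℝ => circlePoint (N * x 0) := by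
    have h : ∀ t, circlePoint t = Real.cos t + Real.sin t * Complex.I := fun t => by
      apply Complex.ext <;>
        simp [circlePoint, Complex.cos_ofReal_re, Complex.sin_ofReal_re]
    simp only [h]
    fun_prop
  have hcR : Continuous fun x : Fin 3 → ℝ =>
      N ^ 2 * rescaledDensity ψ L₁ L₂ L₃ L₄ P φ (x, circlePoint (N * x 0)) N⁻¹ :=
    continuous_const.mul (hR.comp ((continuous_id.prodMk hcpc).prodMk continuous_const))
  have hcφ := hφ.continuous
  simp only [density_helix_eq L₁ L₂ L₃ L₄ hP hφ hN0.ne']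
  calc ∫ x in Ω, N ^ 2 * rescaledDensity ψ L₁ L₂ L₃ L₄ P φ (x, circlePoint (N * x 0)) N⁻¹
      ≤ ∫ x in Ω, N ^ 2 * (-2 * φ x ^ 2 + δ) := by
        refine setIntegral_mono_on (hint hcR) (hint (by fun_prop)) hΩo.measurableSet
          fun x hx => ?_
        exact mul_le_mul_of_nonneg_left
          (hN (x, circlePoint (N * x 0)) ⟨subset_closure hx, hcirc' _⟩).le (sq_nonneg N)
    _ = N ^ 2 * (-2 * J + δ * V) := by
        rw [integral_const_mul, integral_add (hint (by fun_prop)) (hint continuous_const),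
          integral_const_mul, setIntegral_const, smul_eq_mul, mul_comm V]
    _ ≤ -(N ^ 2 * J) := by nlinarith [sq_nonneg N]
    _ < C := by linarith

/-- Ball–Majumdar unboundedness theorem: if `L₄ ≠ 0` then, for any continuous bulk
potential `ψ_B` and any smooth symmetric-traceless boundary data `Q̄`, the Landau -
de Gennes energy is unbounded below among smooth symmetric traceless fields agreeing
with `Q̄` outside a compact subset of `Ω`. -/
theorem landau_de_gennes_unbounded_below
    (Ω : Set (Fin 3 → ℝ)) (hΩne : Ω.Nonempty) (hΩo : IsOpen Ω)
    (hΩb : Bornology.IsBounded Ω)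
    (ψB : (Fin 3 → Fin 3 → ℝ) → ℝ) (hψB : Continuous ψB)
    (L₁ L₂ L₃ L₄ : ℝ) (hL₄ : L₄ ≠ 0)
    (Qbar : (Fin 3 → ℝ) → Fin 3 → Fin 3 → ℝ) (hQbar : ContDiff ℝ (⊤ : ℕ∞) Qbar)
    (hQbarsym : ∀ x i j, Qbar x i j = Qbar x j i)
    (hQbartr : ∀ x, ∑ i, Qbar x i i = 0) :
    ∀ C : ℝ, ∃ Q : (Fin 3 → ℝ) → Fin 3 → Fin 3 → ℝ,
      ContDiff ℝ (⊤ : ℕ∞) Q ∧ (∀ x i j, Q x i j = Q x j i) ∧ (∀ x, ∑ i, Q x i i = 0) ∧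
      (∃ K : Set (Fin 3 → ℝ), IsCompact K ∧ K ⊆ Ω ∧ ∀ x ∉ K, Q x = Qbar x) ∧
      (∫ x in Ω, (ψB (Q x) + L₁ * elastI1 Q x + L₂ * elastI2 Q x +
          L₃ * elastI3 Q x + L₄ * elastI4 Q x)) < C := by
  intro C
  obtain ⟨x₀, hx₀⟩ := hΩne
  obtain ⟨r, hr, hrΩ⟩ := Metric.nhds_basis_closedBall.mem_iff.1 (hΩo.mem_nhds hx₀)
  let χ : ContDiffBump x₀ := ⟨r / 2, r, by positivity, by linarith⟩
  let φ : ContDiffBump x₀ := ⟨r / 4, r / 2, by positivity, by linarith⟩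
  have hχ : ContDiff ℝ (⊤ : ℕ∞) χ := χ.contDiff
  have hφ : ContDiff ℝ (⊤ : ℕ∞) φ := φ.contDiff
  let D : Fin 3 → Fin 3 → ℝ := ![![1, 0, 0], ![0, -1, 0], ![0, 0, 0]]
  let s : ℝ := (-1 - L₁) / L₄
  let P : (Fin 3 → ℝ) → Fin 3 → Fin 3 → ℝ :=
    fun x i j => (1 - χ x) * Qbar x i j + χ x * (s * D i j)
  have hP : ContDiff ℝ (⊤ : ℕ∞) P := by
    refine contDiff_pi.2 fun i => contDiff_pi.2 fun j => ?_
    exact ((contDiff_const.sub hχ).mul (contDiff_pi.1 (contDiff_pi.1 hQbar i) j)).add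
      (hχ.mul contDiff_const)
  have hPφ : ∀ x, φ x ≠ 0 → L₁ + L₄ * P x 0 0 = -1 := by
    intro x hx
    have hx' : x ∈ Metric.ball x₀ (r / 2) := by
      have h : x ∈ Function.support φ := hx
      rwa [φ.support_eq] at h
    have h1 : χ x = 1 := χ.one_of_mem_closedBall (Metric.ball_subset_closedBall hx')
    simp only [P, h1, D, s]
    simp
    field_simp
    ring
  have hφ0 : ∀ x, x ∉ Metric.closedBall x₀ r → φ x = 0 := by
    intro x hx
    refine φ.zero_of_le_dist ?_
    rw [Metric.mem_closedBall, not_le] at hx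
    change r / 2 ≤ _
    linarith
  have hχ0 : ∀ x, x ∉ Metric.closedBall x₀ r → χ x = 0 := by
    intro x hx
    refine χ.zero_of_le_dist ?_
    rw [Metric.mem_closedBall, not_le] at hx
    exact hx.le
  have hφΩ : 0 < ∫ x in Ω, φ x ^ 2 := by
    rw [setIntegral_eq_integral_of_forall_compl_eq_zero fun x hx => by
      rw [hφ0 x fun h => hx (hrΩ h)]; simp]
    refine Continuous.integral_pos_of_hasCompactSupport_nonneg_nonzero
      (x := x₀) (hφ.continuous.pow 2) ?_ (fun x => sq_nonneg _) ?_
    · exact HasCompactSupport.intro (isCompact_closedBall x₀ r) fun x hx => by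
        simp [hφ0 x hx]
    · have h : φ x₀ = 1 := φ.one_of_mem_closedBall (Metric.mem_closedBall_self φ.rIn_pos.le)
      simp [h]
  obtain ⟨N, hN⟩ := exists_energy_helix_lt hΩo hΩb hψB L₁ L₂ L₃ L₄ hP hφ hPφ hφΩ C
  refine ⟨helix P φ N, contDiff_helix hP hφ N, fun x i j => ?_, fun x => ?_,
    ⟨Metric.closedBall x₀ r, isCompact_closedBall x₀ r, hrΩ, fun x hx => ?_⟩, hN⟩
  · have hD : D i j = D j i := by fin_cases i <;> fin_cases j <;> rfl
    have hM (z : ℂ) : planarMatrix z i j = planarMatrix z j i := by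
      fin_cases i <;> fin_cases j <;> rfl
    simp only [helix, P, hQbarsym x i j, hD, hM]
  · have h := hQbartr x
    simp only [Fin.sum_univ_three] at h
    simp [helix, P, Fin.sum_univ_three, D, planarMatrix]
    linear_combination (1 - χ x) * h
  · funext i j
    simp [helix, P, hφ0 x hx, hχ0 x hx]
end
end

section
/- Let L₁, L₂, L₃ ∈ ℝ satisfy L₁ > 0, −L₁ < L₃ < 2L₁, and L₁ + (5/3)L₂ + (1/6)L₃ > 0. Then there exists c > 0 such that for every third-order array H = (H_{ijk})_{i,j,k ∈ {1,2,3}} of real numbers which is symmetric in its first two indices (H_{ijk} = H_{jik} for all i,j,k) and traceless in its first two indices (Σ_i H_{iik} = 0 for all k), one has L₁ Σ_{i,j,k} H_{ijk}² + L₂ Σ_i (Σ_j H_{ijj})(Σ_k H_{ikk}) + L₃ Σ_{i,j,k} H_{ikj} H_{ijk} ≥ c Σ_{i,j,k} H_{ijk}². -/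
open scoped BigOperators

/-- The contraction `V_i = H_{ijj}`. -/
def contraction (H : Fin 3 → Fin 3 → Fin 3 → ℝ) (i : Fin 3) : ℝ := ∑ j, H i j j

/-- For `H` symmetric and traceless in its first two indices, the part of `H` with vanishing
contraction. -/
noncomputable def contractionFree (H : Fin 3 → Fin 3 → Fin 3 → ℝ) (i j k : Fin 3) : ℝ :=
  H i j k - (3 / 10 : ℝ) * ((if i = k then contraction H j else 0) +
    (if j = k then contraction H i else 0) - (2 / 3 : ℝ) * (if i = j then contraction H k else 0))

lemma sum_contractionFree_sub_sq (H : Fin 3 → Fin 3 → Fin 3 → ℝ)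
    (hs : ∀ i j k, H i j k = H j i k) (ht : ∀ k, ∑ i, H i i k = 0) :
    ∑ i, ∑ j, ∑ k, (contractionFree H i j k - contractionFree H i k j) ^ 2 =
      2 * (∑ i, ∑ j, ∑ k, H i j k ^ 2) - 2 * (∑ i, ∑ j, ∑ k, H i k j * H i j k) -
        ∑ i, (∑ j, H i j j) * (∑ k, H i k k) := by
  have ht' : ∀ k, H 2 2 k = -H 0 0 k - H 1 1 k := fun k => by
    have := ht k
    rw [Fin.sum_univ_three] at this
    linarith
  simp [contractionFree, contraction, Fin.sum_univ_three, hs 1 0, hs 2 0, hs 2 1, ht']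
  ring

lemma sum_contractionFree_cyclic_sq (H : Fin 3 → Fin 3 → Fin 3 → ℝ)
    (hs : ∀ i j k, H i j k = H j i k) (ht : ∀ k, ∑ i, H i i k = 0) :
    ∑ i, ∑ j, ∑ k,
        (contractionFree H i j k + contractionFree H j k i + contractionFree H k i j) ^ 2 =
      3 * (∑ i, ∑ j, ∑ k, H i j k ^ 2) + 6 * (∑ i, ∑ j, ∑ k, H i k j * H i j k) -
        (12 / 5 : ℝ) * ∑ i, (∑ j, H i j j) * (∑ k, H i k k) := by
  have ht' : ∀ k, H 2 2 k = -H 0 0 k - H 1 1 k := fun k => by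
    have := ht k
    rw [Fin.sum_univ_three] at this
    linarith
  simp [contractionFree, contraction, Fin.sum_univ_three, hs 1 0, hs 2 0, hs 2 1, ht']
  ring

/-- Davis–Gartland coercivity: under `L₁ > 0`, `−L₁ < L₃ < 2L₁` and
`L₁ + (5/3)L₂ + (1/6)L₃ > 0`, the Landau - de Gennes quadratic elastic energy density
`L₁ H_{ijk}H_{ijk} + L₂ H_{ijj}H_{ikk} + L₃ H_{ikj}H_{ijk}` dominates `c|H|²`
for some `c > 0`, over all third-order arrays `H` that are symmetric and traceless
in their first two indices. -/
theorem elastic_coercivity (L₁ L₂ L₃ : ℝ)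
    (h1 : 0 < L₁) (h2 : -L₁ < L₃) (h3 : L₃ < 2 * L₁)
    (h4 : 0 < L₁ + (5/3 : ℝ) * L₂ + (1/6 : ℝ) * L₃) :
    ∃ c : ℝ, 0 < c ∧ ∀ H : Fin 3 → Fin 3 → Fin 3 → ℝ,
      (∀ i j k, H i j k = H j i k) → (∀ k, ∑ i, H i i k = 0) →
      c * (∑ i, ∑ j, ∑ k, H i j k ^ 2) ≤
        L₁ * (∑ i, ∑ j, ∑ k, H i j k ^ 2) +
        L₂ * (∑ i, (∑ j, H i j j) * (∑ k, H i k k)) +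
        L₃ * (∑ i, ∑ j, ∑ k, H i k j * H i j k) := by
  set M := L₁ + (5/3 : ℝ) * L₂ + (1/6 : ℝ) * L₃
  refine ⟨min M (min (L₁ + L₃) (L₁ - L₃ / 2)), ?_, fun H hs ht => ?_⟩
  · exact lt_min h4 (lt_min (by linarith) (by linarith))
  have hb := sum_contractionFree_sub_sq H hs ht
  have ha := sum_contractionFree_cyclic_sq H hs ht
  have hb0 : 0 ≤ ∑ i, ∑ j, ∑ k, (contractionFree H i j k - contractionFree H i k j) ^ 2 := by
    positivity
  have ha0 : 0 ≤ ∑ i, ∑ j, ∑ k,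
      (contractionFree H i j k + contractionFree H j k i + contractionFree H k i j) ^ 2 := by
    positivity
  have hv0 : 0 ≤ ∑ i, (∑ j, H i j j) * (∑ k, H i k k) :=
    Finset.sum_nonneg fun i _ => mul_self_nonneg _
  rw [hb] at hb0
  rw [ha] at ha0
  clear ha hb
  generalize (∑ i, ∑ j, ∑ k, H i j k ^ 2) = I₁ at *
  generalize (∑ i, (∑ j, H i j j) * (∑ k, H i k k)) = I₂ at *
  generalize (∑ i, ∑ j, ∑ k, H i k j * H i j k) = I₃ at *
  set c := min M (min (L₁ + L₃) (L₁ - L₃ / 2))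
  have hcM : c ≤ M := min_le_left _ _
  have hca : c ≤ L₁ + L₃ := (min_le_right _ _).trans (min_le_left _ _)
  have hcb : c ≤ L₁ - L₃ / 2 := (min_le_right _ _).trans (min_le_right _ _)
  have e₁ := mul_nonneg (sub_nonneg.2 hcM) hv0
  have e₂ := mul_nonneg (sub_nonneg.2 hca) ha0
  have e₃ := mul_nonneg (sub_nonneg.2 hcb) hb0
  linear_combination (3 / 5 : ℝ) * e₁ + (1 / 9 : ℝ) * e₂ + (1 / 3 : ℝ) * e₃
end

section
/- Let Q be a real symmetric 3×3 matrix with tr Q = 0 and minimum eigenvalue λ_min(Q) ≥ −1/3. Then for every third-order array H = (H_{ijk})_{i,j,k ∈ {1,2,3}} of real numbers, −(1/3) Σ_{i,j,k} H_{ijk}² ≤ Σ_{i,j,l,k} Q_{lk} H_{ijl} H_{ijk} ≤ (2/3) Σ_{i,j,k} H_{ijk}². In particular, with I₁ = Q_{ij,k}Q_{ij,k} and I₄ = Q_{lk}Q_{ij,l}Q_{ij,k} evaluated at any gradient H = ∇Q, one has −(1/3)I₁ ≤ I₄ ≤ (2/3)I₁. -/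
open scoped BigOperators

namespace Matrix.IsHermitian

open Matrix

variable {n : Type*} [Fintype n] [DecidableEq n] {A : Matrix n n ℝ}

open scoped MatrixOrder in
/-- A lower bound for the eigenvalues bounds the quadratic form from below. -/
theorem mul_dotProduct_self_le (hA : A.IsHermitian) {c : ℝ}
    (hc : ∀ i, c ≤ hA.eigenvalues i) (v : n → ℝ) : c * (v ⬝ᵥ v) ≤ v ⬝ᵥ A *ᵥ v := by
  have h : algebraMap ℝ (Matrix n n ℝ) c ≤ A := by
    rw [algebraMap_le_iff_le_spectrum (ha := hA), hA.spectrum_real_eq_range_eigenvalues]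
    rintro _ ⟨i, rfl⟩
    exact hc i
  have h' := (Matrix.le_iff.mp h).dotProduct_mulVec_nonneg v
  simpa [sub_mulVec, Algebra.algebraMap_eq_smul_one, smul_mulVec] using h'

open scoped MatrixOrder in
/-- An upper bound for the eigenvalues bounds the quadratic form from above. -/
theorem dotProduct_mulVec_self_le (hA : A.IsHermitian) {c : ℝ}
    (hc : ∀ i, hA.eigenvalues i ≤ c) (v : n → ℝ) : v ⬝ᵥ A *ᵥ v ≤ c * (v ⬝ᵥ v) := by
  have h : A ≤ algebraMap ℝ (Matrix n n ℝ) c := by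
    rw [le_algebraMap_iff_spectrum_le (ha := hA), hA.spectrum_real_eq_range_eigenvalues]
    rintro _ ⟨i, rfl⟩
    exact hc i
  have h' := (Matrix.le_iff.mp h).dotProduct_mulVec_nonneg v
  simpa [sub_mulVec, Algebra.algebraMap_eq_smul_one, smul_mulVec] using h'

end Matrix.IsHermitian

/-- For a real symmetric traceless `3×3` matrix `Q` with minimum eigenvalue `≥ −1/3`,
the cubic contraction `Q_{lk}H_{ijl}H_{ijk}` is bounded between `−(1/3)|H|²` and
`(2/3)|H|²` for every third-order array `H`; in particular `−(1/3)I₁ ≤ I₄ ≤ (2/3)I₁`. -/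
theorem I4_bounds (Q : Matrix (Fin 3) (Fin 3) ℝ) (hQ : Q.IsHermitian)
    (htr : Q.trace = 0) (hmin : ∀ i, -(1/3 : ℝ) ≤ hQ.eigenvalues i)
    (H : Fin 3 → Fin 3 → Fin 3 → ℝ) :
    -(1/3 : ℝ) * (∑ i, ∑ j, ∑ k, H i j k ^ 2) ≤
        (∑ i, ∑ j, ∑ l, ∑ k, Q l k * H i j l * H i j k) ∧
      (∑ i, ∑ j, ∑ l, ∑ k, Q l k * H i j l * H i j k) ≤
        (2/3 : ℝ) * (∑ i, ∑ j, ∑ k, H i j k ^ 2) := by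
  have hsum : ∑ i, hQ.eigenvalues i = 0 := by
    simpa [htr] using hQ.trace_eq_sum_eigenvalues.symm
  have hmax : ∀ i, hQ.eigenvalues i ≤ 2 / 3 := by
    rw [Fin.sum_univ_three] at hsum
    intro i
    have h0 := hmin 0
    have h1 := hmin 1
    have h2 := hmin 2
    fin_cases i <;> simp only [Fin.reduceFinMk, Fin.zero_eta, Fin.mk_one] <;> linarith
  have hnorm (i j) : ∑ k, H i j k ^ 2 = H i j ⬝ᵥ H i j := by
    simp only [dotProduct, sq]
  have hform (i j) :
      ∑ l, ∑ k, Q l k * H i j l * H i j k = H i j ⬝ᵥ Q.mulVec (H i j) := by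
    simp only [dotProduct, Matrix.mulVec, Finset.mul_sum]
    exact Finset.sum_congr rfl fun l _ => Finset.sum_congr rfl fun k _ => by ring
  simp only [hnorm, hform, Finset.mul_sum]
  exact ⟨Finset.sum_le_sum fun i _ => Finset.sum_le_sum fun j _ =>
      hQ.mul_dotProduct_self_le hmin (H i j),
    Finset.sum_le_sum fun i _ => Finset.sum_le_sum fun j _ =>
      hQ.dotProduct_mulVec_self_le hmax (H i j)⟩
end

section
/- Let σ be the surface measure on the unit sphere S² ⊂ ℝ³. For a real symmetric traceless 3×3 matrix Q define f(Q) = inf { ∫_{S²} ρ(p) ln ρ(p) dσ(p) : ρ : S² → ℝ measurable, ρ ≥ 0 a.e., ρ(p) = ρ(−p) for a.e. p, ∫_{S²} ρ dσ = 1, ∫_{S²} (p⊗p − (1/3)I) ρ(p) dσ(p) = Q }. Then there exist constants C₁, C₂ ∈ ℝ such that, for every symmetric traceless Q with λ_min(Q) > −1/3, the infimum f(Q) is finite and C₁ − (1/2) ln( λ_min(Q) + 1/3 ) ≤ f(Q) ≤ C₂ − ln( λ_min(Q) + 1/3 ). In particular f(Q) → +∞ as λ_min(Q) → −1/3 from above.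 -/
open scoped BigOperators
open MeasureTheory Metric

noncomputable section

/-- The surface measure on the unit sphere `S² ⊂ ℝ³`. -/
def sphereMeasure : Measure (sphere (0 : EuclideanSpace ℝ (Fin 3)) 1) :=
  (volume : Measure (EuclideanSpace ℝ (Fin 3))).toSphere

/-- The set of entropies `∫ ρ ln ρ dσ` of head-to-tail symmetric probability densities
`ρ` on `S²` whose Q-tensor `∫ (p⊗p − (1/3)I) ρ dσ` equals `Q`. -/
def admissibleEntropies (Q : Matrix (Fin 3) (Fin 3) ℝ) : Set ℝ :=
  {r | ∃ ρ : sphere (0 : EuclideanSpace ℝ (Fin 3)) 1 → ℝ,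
    Measurable ρ ∧ (∀ᵐ p ∂sphereMeasure, 0 ≤ ρ p) ∧
    (∀ᵐ p ∂sphereMeasure, ρ (-p) = ρ p) ∧
    Integrable ρ sphereMeasure ∧ (∫ p, ρ p ∂sphereMeasure) = 1 ∧
    Integrable (fun p => ρ p * Real.log (ρ p)) sphereMeasure ∧
    (∀ i j, (∫ p, ((p : EuclideanSpace ℝ (Fin 3)) i * (p : EuclideanSpace ℝ (Fin 3)) j -
        (if i = j then (1/3 : ℝ) else 0)) * ρ p ∂sphereMeasure) = Q i j) ∧
    r = ∫ p, ρ p * Real.log (ρ p) ∂sphereMeasure}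

/-- The Ball–Majumdar singular bulk potential `f(Q)`: the minimal entropy `∫ ρ ln ρ dσ`
among admissible densities with Q-tensor `Q`. -/
def singularPotential (Q : Matrix (Fin 3) (Fin 3) ℝ) : ℝ :=
  sInf (admissibleEntropies Q)

lemma measurePreserving_polar :
    MeasurePreserving (homeomorphUnitSphereProd (EuclideanSpace ℝ (Fin 3)))
      ((volume : Measure (EuclideanSpace ℝ (Fin 3))).comap (↑))
      (sphereMeasure.prod (Measure.volumeIoiPow 2)) := by
  simpa [sphereMeasure] using
    (volume : Measure (EuclideanSpace ℝ (Fin 3))).measurePreserving_homeomorphUnitSphereProd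

instance : IsFiniteMeasure sphereMeasure :=
  inferInstanceAs (IsFiniteMeasure (volume : Measure (EuclideanSpace ℝ (Fin 3))).toSphere)

lemma smul_homeomorphUnitSphereProd (x : ({0}ᶜ : Set (EuclideanSpace ℝ (Fin 3)))) :
    ((homeomorphUnitSphereProd _ x).2 : ℝ) •
      ((homeomorphUnitSphereProd _ x).1 : EuclideanSpace ℝ (Fin 3)) = x :=
  congrArg Subtype.val ((homeomorphUnitSphereProd (EuclideanSpace ℝ (Fin 3))).symm_apply_apply x)

lemma integral_polar (G : EuclideanSpace ℝ (Fin 3) → ℝ) :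
    ∫ q : sphere (0 : EuclideanSpace ℝ (Fin 3)) 1 × Set.Ioi (0 : ℝ),
      G ((q.2 : ℝ) • (q.1 : EuclideanSpace ℝ (Fin 3)))
        ∂(sphereMeasure.prod (Measure.volumeIoiPow 2)) = ∫ x, G x := by
  rw [← measurePreserving_polar.integral_comp (Homeomorph.measurableEmbedding _)]
  simp only [smul_homeomorphUnitSphereProd]
  rw [integral_subtype_comap (measurableSet_singleton _).compl, restrict_compl_singleton]

lemma integrable_polar {G : EuclideanSpace ℝ (Fin 3) → ℝ} (hG : Integrable G) :
    Integrable (fun q : sphere (0 : EuclideanSpace ℝ (Fin 3)) 1 × Set.Ioi (0 : ℝ) =>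
      G ((q.2 : ℝ) • (q.1 : EuclideanSpace ℝ (Fin 3))))
        (sphereMeasure.prod (Measure.volumeIoiPow 2)) := by
  rw [← measurePreserving_polar.integrable_comp_emb (Homeomorph.measurableEmbedding _)]
  simp only [Function.comp_def, smul_homeomorphUnitSphereProd]
  have := (integrableOn_iff_comap_subtypeVal (μ := volume)
    (measurableSet_singleton (0 : EuclideanSpace ℝ (Fin 3))).compl).1 hG.integrableOn
  exact this

lemma integral_prod_repr (b : OrthonormalBasis (Fin 3) ℝ (EuclideanSpace ℝ (Fin 3)))
    (h : Fin 3 → ℝ → ℝ) : ∫ x, ∏ k, h k (b.repr x k) = ∏ k, ∫ t, h k t := by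
  rw [← integral_fintype_prod_volume_eq_prod,
    ← (PiLp.volume_preserving_ofLp (Fin 3)).integral_comp
      (MeasurableEquiv.toLp 2 (Fin 3 → ℝ)).symm.measurableEmbedding]
  exact b.measurePreserving_repr.integral_comp b.repr.toHomeomorph.measurableEmbedding
    (fun y => ∏ k, h k (y k))

lemma integrable_prod_repr (b : OrthonormalBasis (Fin 3) ℝ (EuclideanSpace ℝ (Fin 3)))
    {h : Fin 3 → ℝ → ℝ} (hh : ∀ k, Integrable (h k)) :
    Integrable (fun x => ∏ k, h k (b.repr x k)) :=
  b.measurePreserving_repr.integrable_comp_of_integrable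
    ((PiLp.volume_preserving_ofLp (Fin 3)).integrable_comp_of_integrable
      (Integrable.fintype_prod hh))

lemma volumeIoiPow_two_real_Iio {t : ℝ} (ht : 0 < t) :
    (Measure.volumeIoiPow 2).real (Set.Iio (⟨t, Set.mem_Ioi.2 ht⟩ : Set.Ioi (0 : ℝ))) = t ^ 3 / 3 := by
  rw [measureReal_def, Measure.volumeIoiPow_apply_Iio, ENNReal.toReal_ofReal (by positivity)]
  norm_num

lemma volumeIoiPow_two_Iio_ne_top {t : ℝ} (ht : 0 < t) :
    (Measure.volumeIoiPow 2) (Set.Iio (⟨t, Set.mem_Ioi.2 ht⟩ : Set.Ioi (0 : ℝ))) ≠ ⊤ := by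
  simp [Measure.volumeIoiPow_apply_Iio]

lemma repr_sq_le_one (b : OrthonormalBasis (Fin 3) ℝ (EuclideanSpace ℝ (Fin 3)))
    (p : sphere (0 : EuclideanSpace ℝ (Fin 3)) 1) (k : Fin 3) : (b.repr p k) ^ 2 ≤ 1 := by
  have h : ∑ l, (b.repr p l) ^ 2 = 1 := by
    rw [← EuclideanSpace.real_norm_sq_eq, b.repr.norm_map, norm_eq_of_mem_sphere, one_pow]
  refine le_of_le_of_eq ?_ h
  exact Finset.single_le_sum (f := fun l => (b.repr p l) ^ 2) (fun _ _ => sq_nonneg _)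
    (Finset.mem_univ k)

/-- The mass of a Gaussian band of width `√m` around a great circle is `O(√m)`. -/
lemma exists_integral_band_le : ∃ C : ℝ,
    ∀ (b : OrthonormalBasis (Fin 3) ℝ (EuclideanSpace ℝ (Fin 3))) (k : Fin 3) {m : ℝ}, 0 < m →
      ∫ p, Real.exp (-(b.repr (p : EuclideanSpace ℝ (Fin 3)) k) ^ 2 / m) ∂sphereMeasure
        ≤ C * √m := by
  refine ⟨3 * Real.exp 3 * √Real.pi ^ 3, fun b k m hm => ?_⟩
  let c : Fin 3 → ℝ := fun l => if l = k then m⁻¹ else 1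
  have hc : ∀ l, 0 < c l := fun l => by dsimp only [c]; split_ifs <;> positivity
  have h_int := integrable_prod_repr b (fun l => integrable_exp_neg_mul_sq (hc l))
  have hval := integral_prod_repr b (fun l t => Real.exp (-c l * t ^ 2))
  have hprod : ∏ l, ∫ t, Real.exp (-c l * t ^ 2) = √Real.pi ^ 3 * √m := by
    have hs : √(Real.pi * m) = √Real.pi * √m := Real.sqrt_mul Real.pi_pos.le _
    simp only [integral_gaussian, Fin.prod_univ_three, c]
    fin_cases k <;> simp [hs] <;> ring
  rw [hprod, ← integral_polar] at hval
  have hind : Integrable ((Set.Iio (⟨1, Set.mem_Ioi.2 one_pos⟩ : Set.Ioi (0 : ℝ))).indicator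
      (fun _ => (1 : ℝ))) (Measure.volumeIoiPow 2) :=
    (integrable_indicator_iff measurableSet_Iio).2
      (integrableOn_const (volumeIoiPow_two_Iio_ne_top one_pos))
  have hf : Integrable (fun p : sphere (0 : EuclideanSpace ℝ (Fin 3)) 1 =>
      Real.exp (-3) * Real.exp (-(b.repr (p : EuclideanSpace ℝ (Fin 3)) k) ^ 2 / m))
      sphereMeasure := by
    refine Integrable.of_bound (C := 1) (Continuous.aestronglyMeasurable (by fun_prop))
      (Filter.Eventually.of_forall fun p => ?_)
    rw [← Real.exp_add, Real.norm_eq_abs, Real.abs_exp, Real.exp_le_one_iff, neg_div]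
    have : 0 ≤ (b.repr (p : EuclideanSpace ℝ (Fin 3)) k) ^ 2 / m := by positivity
    linarith
  have hmono := integral_mono (hf.mul_prod hind) (integrable_polar h_int) (fun q => by
    obtain ⟨p, r, hr⟩ := q
    by_cases h1 : r < 1
    · have hmem : (⟨r, hr⟩ : Set.Ioi (0 : ℝ)) ∈
          Set.Iio (⟨1, Set.mem_Ioi.2 one_pos⟩ : Set.Ioi (0 : ℝ)) := h1
      simp only [Set.indicator_of_mem hmem, mul_one, ← Real.exp_add, ← Real.exp_sum,
        map_smul, PiLp.smul_apply, smul_eq_mul, Real.exp_le_exp]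
      have hr2 : r ^ 2 ≤ 1 := pow_le_one₀ (le_of_lt hr) h1.le
      have key : ∀ l, -(if l = k then (b.repr p k) ^ 2 / m else 1) ≤
          -c l * (r * b.repr p l) ^ 2 := by
        intro l
        dsimp only [c]
        split_ifs with hl
        · subst hl
          have : 0 ≤ (b.repr (p : EuclideanSpace ℝ (Fin 3)) l) ^ 2 * m⁻¹ := by positivity
          rw [div_eq_mul_inv, mul_pow]
          nlinarith
        · have := repr_sq_le_one b p l
          nlinarith [sq_nonneg (b.repr (p : EuclideanSpace ℝ (Fin 3)) l)]
      refine le_trans ?_ (Finset.sum_le_sum fun l _ => key l)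
      rw [Fin.sum_univ_three]
      fin_cases k <;> simp <;> ring_nf <;> linarith
    · have hmem : (⟨r, hr⟩ : Set.Ioi (0 : ℝ)) ∉
          Set.Iio (⟨1, Set.mem_Ioi.2 one_pos⟩ : Set.Ioi (0 : ℝ)) := h1
      simp only [Set.indicator_of_notMem hmem, mul_zero]
      positivity)
  replace hmono := (integral_prod_mul (μ := sphereMeasure) (ν := Measure.volumeIoiPow 2)
    (fun p : sphere (0 : EuclideanSpace ℝ (Fin 3)) 1 =>
      Real.exp (-3) * Real.exp (-(b.repr (p : EuclideanSpace ℝ (Fin 3)) k) ^ 2 / m))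
    ((Set.Iio (⟨1, Set.mem_Ioi.2 one_pos⟩ : Set.Ioi (0 : ℝ))).indicator
      (fun _ => (1 : ℝ)))).symm.trans_le hmono
  rw [hval, integral_const_mul, integral_indicator measurableSet_Iio,
    setIntegral_const, volumeIoiPow_two_real_Iio one_pos] at hmono
  have he : Real.exp 3 * Real.exp (-3) = 1 := by rw [← Real.exp_add]; simp
  have h3 := mul_le_mul_of_nonneg_left hmono (by positivity : 0 ≤ 3 * Real.exp 3)
  simp only [smul_eq_mul] at h3
  linear_combination h3 + (-∫ p, Real.exp (-(b.repr (p : EuclideanSpace ℝ (Fin 3)) k) ^ 2 / m)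
    ∂sphereMeasure) * he

lemma repr_apply_eq_sum (b : OrthonormalBasis (Fin 3) ℝ (EuclideanSpace ℝ (Fin 3)))
    (x : EuclideanSpace ℝ (Fin 3)) (k : Fin 3) : b.repr x k = ∑ i, b k i * x i := by
  rw [b.repr_apply_apply, PiLp.inner_apply]
  exact Finset.sum_congr rfl fun i _ => by simp [mul_comm]

lemma apply_eq_sum_repr (b : OrthonormalBasis (Fin 3) ℝ (EuclideanSpace ℝ (Fin 3)))
    (x : EuclideanSpace ℝ (Fin 3)) (i : Fin 3) : x i = ∑ k, b.repr x k * b k i := by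
  conv_lhs => rw [← b.sum_repr x]
  simp

lemma sphere_sum_sq (p : sphere (0 : EuclideanSpace ℝ (Fin 3)) 1) :
    ∑ i, (p : EuclideanSpace ℝ (Fin 3)) i ^ 2 = 1 := by
  rw [← EuclideanSpace.real_norm_sq_eq, norm_eq_of_mem_sphere, one_pow]

lemma abs_sphere_apply_le_one (p : sphere (0 : EuclideanSpace ℝ (Fin 3)) 1) (i : Fin 3) :
    |(p : EuclideanSpace ℝ (Fin 3)) i| ≤ 1 := by
  simpa using PiLp.norm_apply_le (p : EuclideanSpace ℝ (Fin 3)) i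

lemma measurable_sphere_apply (i : Fin 3) :
    Measurable fun p : sphere (0 : EuclideanSpace ℝ (Fin 3)) 1 =>
      (p : EuclideanSpace ℝ (Fin 3)) i :=
  Continuous.measurable (by fun_prop)

lemma integrable_qTensor_mul {ρ : sphere (0 : EuclideanSpace ℝ (Fin 3)) 1 → ℝ}
    (hρ : Integrable ρ sphereMeasure) (i j : Fin 3) :
    Integrable (fun p : sphere (0 : EuclideanSpace ℝ (Fin 3)) 1 =>
      ((p : EuclideanSpace ℝ (Fin 3)) i * (p : EuclideanSpace ℝ (Fin 3)) j -
        (if i = j then (1/3 : ℝ) else 0)) * ρ p) sphereMeasure := by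
  refine hρ.bdd_mul (c := 2) (Continuous.aestronglyMeasurable (by fun_prop))
    (Filter.Eventually.of_forall fun p => ?_)
  refine (norm_sub_le _ _).trans ?_
  have h1 : ‖(p : EuclideanSpace ℝ (Fin 3)) i * (p : EuclideanSpace ℝ (Fin 3)) j‖ ≤ 1 := by
    rw [norm_mul]
    exact mul_le_one₀ (abs_sphere_apply_le_one p i) (norm_nonneg _) (abs_sphere_apply_le_one p j)
  have h2 : ‖(if i = j then (1/3 : ℝ) else 0)‖ ≤ 1 := by split_ifs <;> norm_num
  linarith

lemma eigenvalue_eq_sum {Q : Matrix (Fin 3) (Fin 3) ℝ} (hQ : Q.IsHermitian) (k : Fin 3) :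
    hQ.eigenvalues k = ∑ i, ∑ j, hQ.eigenvectorBasis k i * hQ.eigenvectorBasis k j * Q i j := by
  rw [hQ.eigenvalues_eq k]
  simp only [dotProduct, Matrix.mulVec, Finset.mul_sum]
  simp only [RCLike.re_to_real, Pi.star_apply, star_trivial]
  exact Finset.sum_congr rfl fun i _ => Finset.sum_congr rfl fun j _ => by ring

lemma apply_eq_sum_eigenvalues {Q : Matrix (Fin 3) (Fin 3) ℝ} (hQ : Q.IsHermitian)
    (i j : Fin 3) :
    Q i j = ∑ k, hQ.eigenvalues k * hQ.eigenvectorBasis k i * hQ.eigenvectorBasis k j := by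
  conv_lhs => rw [hQ.spectral_theorem, Unitary.conjStarAlgAut_apply]
  simp only [Matrix.mul_apply, Matrix.diagonal_apply, Matrix.star_apply,
    Matrix.IsHermitian.eigenvectorUnitary_apply, Function.comp_apply, star_trivial]
  refine Finset.sum_congr rfl fun k _ => ?_
  simp only [mul_ite, mul_zero, Finset.sum_ite_eq', Finset.mem_univ, if_true,
    RCLike.ofReal_real_eq_id, id_eq]
  ring

lemma sum_eigenvectorBasis_mul (b : OrthonormalBasis (Fin 3) ℝ (EuclideanSpace ℝ (Fin 3)))
    (i j : Fin 3) : ∑ k, b k i * b k j = if i = j then 1 else 0 := by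
  have h := apply_eq_sum_repr b (EuclideanSpace.single j 1) i
  simp only [repr_apply_eq_sum, PiLp.single_apply, mul_ite, mul_one, mul_zero,
    Finset.sum_ite_eq', Finset.mem_univ, if_true] at h
  rw [h]
  exact Finset.sum_congr rfl fun k _ => mul_comm _ _

lemma second_moment_eq {ρ : sphere (0 : EuclideanSpace ℝ (Fin 3)) 1 → ℝ}
    (hρ : Integrable ρ sphereMeasure) (h1 : ∫ p, ρ p ∂sphereMeasure = 1)
    {Q : Matrix (Fin 3) (Fin 3) ℝ} (hQ : Q.IsHermitian)
    (hm : ∀ i j, (∫ p, ((p : EuclideanSpace ℝ (Fin 3)) i * (p : EuclideanSpace ℝ (Fin 3)) j -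
        (if i = j then (1/3 : ℝ) else 0)) * ρ p ∂sphereMeasure) = Q i j) (k : Fin 3) :
    ∫ p, (hQ.eigenvectorBasis.repr (p : EuclideanSpace ℝ (Fin 3)) k) ^ 2 * ρ p ∂sphereMeasure
      = hQ.eigenvalues k + 1 / 3 := by
  set b := hQ.eigenvectorBasis
  have hb : ∑ i, b k i ^ 2 = 1 := by
    rw [← EuclideanSpace.real_norm_sq_eq, b.norm_eq_one, one_pow]
  have hpt : ∀ p : sphere (0 : EuclideanSpace ℝ (Fin 3)) 1,
      (b.repr (p : EuclideanSpace ℝ (Fin 3)) k) ^ 2 * ρ p =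
      (∑ i, ∑ j, b k i * b k j * (((p : EuclideanSpace ℝ (Fin 3)) i *
        (p : EuclideanSpace ℝ (Fin 3)) j - (if i = j then (1/3 : ℝ) else 0)) * ρ p))
        + 1 / 3 * ρ p := by
    intro p
    rw [repr_apply_eq_sum]
    simp only [Fin.sum_univ_three] at hb ⊢
    simp
    linear_combination (ρ p / 3) * hb
  have h_int := fun i j => (integrable_qTensor_mul hρ i j).const_mul (b k i * b k j)
  simp only [hpt]
  rw [integral_add (integrable_finsetSum _ fun i _ => integrable_finsetSum _ fun j _ => h_int i j)
    (hρ.const_mul _), integral_finsetSum _ (fun i _ => integrable_finsetSum _ fun j _ => h_int i j),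
    integral_const_mul, h1, eigenvalue_eq_sum hQ k]
  simp only [integral_finsetSum _ fun j _ => h_int _ j, integral_const_mul, hm, mul_one, b]

/-- Gibbs' inequality at a point. -/
lemma sub_exp_le_mul_log_sub {x : ℝ} (hx : 0 ≤ x) (g : ℝ) :
    x * g + x - Real.exp g ≤ x * Real.log x := by
  rcases hx.eq_or_lt with rfl | hx
  · simpa using (Real.exp_pos g).le
  · have h := Real.add_one_le_exp (g - Real.log x)
    rw [Real.exp_sub, Real.exp_log hx, le_div_iff₀ hx] at h
    linarith

lemma entropy_lower_bound : ∃ C : ℝ, ∀ {Q : Matrix (Fin 3) (Fin 3) ℝ} (hQ : Q.IsHermitian)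
    (k : Fin 3), 0 < hQ.eigenvalues k + 1 / 3 → ∀ r ∈ admissibleEntropies Q,
      C - (1 / 2 : ℝ) * Real.log (hQ.eigenvalues k + 1 / 3) ≤ r := by
  obtain ⟨C, hC⟩ := exists_integral_band_le
  refine ⟨-C, fun {Q} hQ k hk r hr => ?_⟩
  obtain ⟨ρ, -, h0, -, hρ, h1, hent, hmom, rfl⟩ := hr
  have h2 := second_moment_eq hρ h1 hQ hmom k
  have hband := hC hQ.eigenvectorBasis k hk
  set m := hQ.eigenvalues k + 1 / 3
  set b := hQ.eigenvectorBasis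
  have hmom_int : Integrable (fun p : sphere (0 : EuclideanSpace ℝ (Fin 3)) 1 =>
      (b.repr (p : EuclideanSpace ℝ (Fin 3)) k) ^ 2 * ρ p) sphereMeasure := by
    refine hρ.bdd_mul (c := 1) (Continuous.aestronglyMeasurable (by fun_prop))
      (Filter.Eventually.of_forall fun p => ?_)
    rw [Real.norm_eq_abs, abs_of_nonneg (sq_nonneg _)]
    exact repr_sq_le_one b p k
  have hexp_int : Integrable (fun p : sphere (0 : EuclideanSpace ℝ (Fin 3)) 1 =>
      Real.exp (-(b.repr (p : EuclideanSpace ℝ (Fin 3)) k) ^ 2 / m)) sphereMeasure := by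
    refine Integrable.of_bound (C := 1) (Continuous.aestronglyMeasurable (by fun_prop))
      (Filter.Eventually.of_forall fun p => ?_)
    rw [Real.norm_eq_abs, Real.abs_exp, Real.exp_le_one_iff, neg_div]
    exact neg_nonpos.2 (by positivity)
  have hsqrt : Real.exp (-(1 / 2) * Real.log m) = (√m)⁻¹ := by
    rw [neg_mul, Real.exp_neg, one_div_mul_eq_div, ← Real.log_sqrt hk.le,
      Real.exp_log (Real.sqrt_pos.2 hk)]
  have hle : ∀ᵐ p ∂sphereMeasure,
      (1 - 1 / 2 * Real.log m) * ρ p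
        - m⁻¹ * ((b.repr (p : EuclideanSpace ℝ (Fin 3)) k) ^ 2 * ρ p)
        - (√m)⁻¹ * Real.exp (-(b.repr (p : EuclideanSpace ℝ (Fin 3)) k) ^ 2 / m)
        ≤ ρ p * Real.log (ρ p) := by
    filter_upwards [h0] with p hp
    have := sub_exp_le_mul_log_sub hp
      (-(1 / 2) * Real.log m + -(b.repr (p : EuclideanSpace ℝ (Fin 3)) k) ^ 2 / m)
    rw [Real.exp_add, hsqrt] at this
    refine le_trans (le_of_eq ?_) this
    ring
  have hdiff : Integrable (fun p : sphere (0 : EuclideanSpace ℝ (Fin 3)) 1 =>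
      (1 - 1 / 2 * Real.log m) * ρ p
        - m⁻¹ * ((b.repr (p : EuclideanSpace ℝ (Fin 3)) k) ^ 2 * ρ p)) sphereMeasure :=
    (hρ.const_mul _).sub (hmom_int.const_mul _)
  have hI := integral_mono_ae (hdiff.sub (hexp_int.const_mul _)) hent hle
  rw [integral_sub' hdiff (hexp_int.const_mul _),
    integral_sub (hρ.const_mul _) (hmom_int.const_mul _), integral_const_mul, integral_const_mul,
    integral_const_mul, h1, h2, inv_mul_cancel₀ hk.ne'] at hI
  have hs : 0 < √m := Real.sqrt_pos.2 hk
  have hlast := mul_le_mul_of_nonneg_left hband (inv_nonneg.2 hs.le)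
  rw [mul_comm C, inv_mul_cancel_left₀ hs.ne'] at hlast
  linarith

lemma integrable_pow_mul_box (a : ℝ) (n : ℕ) :
    Integrable (fun t : ℝ => t ^ n *
      (Set.Icc (-a) a).indicator (fun _ => (2 * a)⁻¹) t) := by
  have h : Integrable ((Set.Icc (-a) a).indicator (fun t : ℝ => t ^ n * (2 * a)⁻¹)) :=
    (integrable_indicator_iff measurableSet_Icc).2
      (Continuous.integrableOn_Icc (by fun_prop))
  refine h.congr (Filter.Eventually.of_forall fun t => ?_)
  by_cases ht : t ∈ Set.Icc (-a) a <;> simp [ht]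

lemma integral_pow_mul_box {a : ℝ} (ha : 0 < a) (n : ℕ) :
    ∫ t : ℝ, t ^ n * (Set.Icc (-a) a).indicator (fun _ => (2 * a)⁻¹) t =
      (a ^ (n + 1) - (-a) ^ (n + 1)) / (n + 1) * (2 * a)⁻¹ := by
  have h : ∀ t : ℝ, t ^ n * (Set.Icc (-a) a).indicator (fun _ => (2 * a)⁻¹) t =
      (Set.Icc (-a) a).indicator (fun t : ℝ => t ^ n * (2 * a)⁻¹) t := fun t => by
    by_cases ht : t ∈ Set.Icc (-a) a <;> simp [ht]
  simp only [h]
  rw [integral_indicator measurableSet_Icc, integral_Icc_eq_integral_Ioc,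
    ← intervalIntegral.integral_of_le (by linarith), intervalIntegral.integral_mul_const,
    integral_pow]

/-- The uniform probability density on the box with half-sides `a` in the basis `b`. -/
def boxDensity (b : OrthonormalBasis (Fin 3) ℝ (EuclideanSpace ℝ (Fin 3))) (a : Fin 3 → ℝ)
    (x : EuclideanSpace ℝ (Fin 3)) : ℝ :=
  ∏ k, (Set.Icc (-a k) (a k)).indicator (fun _ => (2 * a k)⁻¹) (b.repr x k)

section boxDensity

variable (b : OrthonormalBasis (Fin 3) ℝ (EuclideanSpace ℝ (Fin 3))) {a : Fin 3 → ℝ}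

lemma repr_mul_boxDensity (i j : Fin 3) (x : EuclideanSpace ℝ (Fin 3)) :
    b.repr x i * b.repr x j * boxDensity b a x =
      ∏ k, (b.repr x k) ^ ((if k = i then 1 else 0) + (if k = j then 1 else 0)) *
        (Set.Icc (-a k) (a k)).indicator (fun _ => (2 * a k)⁻¹) (b.repr x k) := by
  rw [Finset.prod_mul_distrib, boxDensity]
  congr 1
  simp only [pow_add, Finset.prod_mul_distrib, pow_ite, pow_one, pow_zero, Finset.prod_ite_eq',
    Finset.mem_univ, if_true]

lemma integrable_repr_mul_boxDensity (i j : Fin 3) :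
    Integrable fun x => b.repr x i * b.repr x j * boxDensity b a x := by
  simp only [repr_mul_boxDensity]
  exact integrable_prod_repr b (h := fun k t =>
    t ^ ((if k = i then 1 else 0) + (if k = j then 1 else 0)) *
      (Set.Icc (-a k) (a k)).indicator (fun _ => (2 * a k)⁻¹) t)
    fun k => integrable_pow_mul_box _ _

lemma integral_repr_mul_boxDensity (ha : ∀ k, 0 < a k) (i j : Fin 3) :
    ∫ x, b.repr x i * b.repr x j * boxDensity b a x = if i = j then a i ^ 2 / 3 else 0 := by
  simp only [repr_mul_boxDensity]
  rw [integral_prod_repr b (fun k t =>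
    t ^ ((if k = i then 1 else 0) + (if k = j then 1 else 0)) *
      (Set.Icc (-a k) (a k)).indicator (fun _ => (2 * a k)⁻¹) t)]
  simp only [integral_pow_mul_box (ha _), Fin.prod_univ_three]
  have h0 := (ha 0).ne'
  have h1 := (ha 1).ne'
  have h2 := (ha 2).ne'
  fin_cases i <;> fin_cases j <;> simp <;> field_simp <;> ring

lemma mul_boxDensity_eq (i j : Fin 3) (x : EuclideanSpace ℝ (Fin 3)) :
    x i * x j * boxDensity b a x =
      ∑ k, ∑ l, b k i * b l j * (b.repr x k * b.repr x l * boxDensity b a x) := by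
  rw [apply_eq_sum_repr b x i, apply_eq_sum_repr b x j, Finset.sum_mul_sum, Finset.sum_mul]
  refine Finset.sum_congr rfl fun k _ => ?_
  rw [Finset.sum_mul]
  exact Finset.sum_congr rfl fun l _ => by ring

lemma integrable_mul_boxDensity (i j : Fin 3) :
    Integrable fun x : EuclideanSpace ℝ (Fin 3) => x i * x j * boxDensity b a x := by
  simp only [mul_boxDensity_eq]
  exact integrable_finsetSum _ fun k _ => integrable_finsetSum _ fun l _ =>
    (integrable_repr_mul_boxDensity b k l).const_mul _

lemma integral_mul_boxDensity (ha : ∀ k, 0 < a k) (i j : Fin 3) :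
    ∫ x : EuclideanSpace ℝ (Fin 3), x i * x j * boxDensity b a x =
      ∑ k, a k ^ 2 / 3 * b k i * b k j := by
  have h_int := fun k l => (integrable_repr_mul_boxDensity b (a := a) k l).const_mul (b k i * b l j)
  simp only [mul_boxDensity_eq]
  rw [integral_finsetSum _ fun k _ => integrable_finsetSum _ fun l _ => h_int k l]
  simp only [integral_finsetSum _ fun l _ => h_int _ l, integral_const_mul,
    integral_repr_mul_boxDensity b ha, mul_ite, mul_zero, Finset.sum_ite_eq, Finset.mem_univ,
    if_true]
  exact Finset.sum_congr rfl fun k _ => by ring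

lemma measurable_boxDensity : Measurable (boxDensity b a) := by
  refine Finset.measurable_fun_prod _ fun k _ => ?_
  exact (measurable_const.indicator measurableSet_Icc).comp
    (Continuous.measurable (by fun_prop : Continuous fun x => b.repr x k))

lemma boxDensity_neg (x : EuclideanSpace ℝ (Fin 3)) :
    boxDensity b a (-x) = boxDensity b a x := by
  refine Finset.prod_congr rfl fun k _ => ?_
  simp only [map_neg, PiLp.neg_apply, Set.indicator_apply, Set.mem_Icc, neg_le_neg_iff,
    neg_le (a := b.repr x k), and_comm]

lemma boxDensity_nonneg (ha : ∀ k, 0 < a k) (x : EuclideanSpace ℝ (Fin 3)) :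
    0 ≤ boxDensity b a x :=
  Finset.prod_nonneg fun k _ => Set.indicator_nonneg (fun _ _ => by have := ha k; positivity) _

lemma boxDensity_le (ha : ∀ k, 0 < a k) (x : EuclideanSpace ℝ (Fin 3)) :
    boxDensity b a x ≤ ∏ k, (2 * a k)⁻¹ := by
  have h : ∀ k, 0 ≤ (2 * a k)⁻¹ := fun k => by have := ha k; positivity
  exact Finset.prod_le_prod (fun k _ => Set.indicator_nonneg (fun _ _ => h k) _)
    fun k _ => Set.indicator_le_self' (fun _ _ => h k) _

lemma boxDensity_eq_zero {x : EuclideanSpace ℝ (Fin 3)} (hx : ∑ k, a k ^ 2 < ‖x‖ ^ 2) :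
    boxDensity b a x = 0 := by
  by_contra h
  rw [boxDensity, ← ne_eq, Finset.prod_ne_zero_iff] at h
  refine hx.not_ge ?_
  rw [← b.repr.norm_map, EuclideanSpace.real_norm_sq_eq]
  refine Finset.sum_le_sum fun k hk => ?_
  have := Set.mem_of_indicator_ne_zero (h k hk)
  exact sq_le_sq' this.1 this.2

end boxDensity

/-- The density on the sphere of the radial projection of the measure `‖x‖² F(x) dx`. -/
def radialDensity (F : EuclideanSpace ℝ (Fin 3) → ℝ)
    (p : sphere (0 : EuclideanSpace ℝ (Fin 3)) 1) : ℝ :=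
  ∫ r : Set.Ioi (0 : ℝ), (r : ℝ) ^ 2 * F ((r : ℝ) • (p : EuclideanSpace ℝ (Fin 3)))
    ∂(Measure.volumeIoiPow 2)

lemma measurable_radialDensity {F : EuclideanSpace ℝ (Fin 3) → ℝ} (hF : Measurable F) :
    Measurable (radialDensity F) := by
  refine (StronglyMeasurable.integral_prod_right
    (f := fun (p : sphere (0 : EuclideanSpace ℝ (Fin 3)) 1) (r : Set.Ioi (0 : ℝ)) =>
      (r : ℝ) ^ 2 * F ((r : ℝ) • (p : EuclideanSpace ℝ (Fin 3)))) ?_).measurable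
  refine Measurable.stronglyMeasurable (Measurable.mul (by fun_prop) (hF.comp ?_))
  exact Continuous.measurable (by fun_prop)

lemma integral_mul_radialDensity {F : EuclideanSpace ℝ (Fin 3) → ℝ} (i j : Fin 3)
    (hF : Integrable fun x : EuclideanSpace ℝ (Fin 3) => x i * x j * F x) :
    ∫ p : sphere (0 : EuclideanSpace ℝ (Fin 3)) 1, (p : EuclideanSpace ℝ (Fin 3)) i *
      (p : EuclideanSpace ℝ (Fin 3)) j * radialDensity F p ∂sphereMeasure =
      ∫ x : EuclideanSpace ℝ (Fin 3), x i * x j * F x := by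
  rw [← integral_polar, integral_prod _ (integrable_polar hF)]
  refine integral_congr_ae (Filter.Eventually.of_forall fun p => ?_)
  simp only [radialDensity]
  rw [← integral_const_mul]
  refine integral_congr_ae (Filter.Eventually.of_forall fun r => ?_)
  simp only [PiLp.smul_apply, smul_eq_mul]
  ring

lemma radialDensity_nonneg {F : EuclideanSpace ℝ (Fin 3) → ℝ} (hF : ∀ x, 0 ≤ F x)
    (p : sphere (0 : EuclideanSpace ℝ (Fin 3)) 1) : 0 ≤ radialDensity F p :=
  integral_nonneg fun _ => mul_nonneg (sq_nonneg _) (hF _)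

lemma radialDensity_le {F : EuclideanSpace ℝ (Fin 3) → ℝ} {B : ℝ} (h0 : ∀ x, 0 ≤ F x)
    (hB : ∀ x, F x ≤ B) (hsupp : ∀ x, 3 < ‖x‖ ^ 2 → F x = 0)
    (p : sphere (0 : EuclideanSpace ℝ (Fin 3)) 1) : radialDensity F p ≤ 36 * B := by
  have hB0 : 0 ≤ B := (h0 0).trans (hB 0)
  have hind : Integrable ((Set.Iio (⟨3, Set.mem_Ioi.2 three_pos⟩ : Set.Ioi (0 : ℝ))).indicator
      (fun _ => 4 * B)) (Measure.volumeIoiPow 2) :=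
    (integrable_indicator_iff measurableSet_Iio).2
      (integrableOn_const (volumeIoiPow_two_Iio_ne_top three_pos))
  have h := integral_mono_of_nonneg (μ := Measure.volumeIoiPow 2)
    (f := fun r : Set.Ioi (0 : ℝ) =>
      (r : ℝ) ^ 2 * F ((r : ℝ) • (p : EuclideanSpace ℝ (Fin 3))))
    (Filter.Eventually.of_forall fun r => mul_nonneg (sq_nonneg _) (h0 _)) hind
    (Filter.Eventually.of_forall fun r => by
      obtain ⟨r, hr⟩ := r
      have hr0 : 0 < r := hr
      by_cases h2 : r ≤ 2
      · have hmem : (⟨r, hr⟩ : Set.Ioi (0 : ℝ)) ∈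
            Set.Iio (⟨3, Set.mem_Ioi.2 three_pos⟩ : Set.Ioi (0 : ℝ)) :=
          show r < 3 by linarith
        simp only [Set.indicator_of_mem hmem]
        exact mul_le_mul (by nlinarith) (hB _) (h0 _) (by norm_num)
      · have hz : F (r • (p : EuclideanSpace ℝ (Fin 3))) = 0 := by
          refine hsupp _ ?_
          rw [norm_smul, norm_eq_of_mem_sphere, mul_one, Real.norm_eq_abs, sq_abs]
          nlinarith
        simp only [hz, mul_zero]
        exact Set.indicator_nonneg (fun _ _ => by positivity) _)
  rw [integral_indicator measurableSet_Iio, setIntegral_const,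
    volumeIoiPow_two_real_Iio three_pos, smul_eq_mul] at h
  refine h.trans (le_of_eq ?_)
  ring

lemma entropy_of_bounded {ρ : sphere (0 : EuclideanSpace ℝ (Fin 3)) 1 → ℝ} {K : ℝ}
    (hmeas : Measurable ρ) (h0 : ∀ p, 0 ≤ ρ p) (hK : ∀ p, ρ p ≤ K)
    (h1 : ∫ p, ρ p ∂sphereMeasure = 1) :
    Integrable (fun p => ρ p * Real.log (ρ p)) sphereMeasure ∧
      ∫ p, ρ p * Real.log (ρ p) ∂sphereMeasure ≤ Real.log K := by
  have hρ : Integrable ρ sphereMeasure :=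
    Integrable.of_bound (C := K) hmeas.aestronglyMeasurable
      (Filter.Eventually.of_forall fun p => by rw [Real.norm_of_nonneg (h0 p)]; exact hK p)
  obtain ⟨B, hB⟩ := (isCompact_Icc (a := (0 : ℝ)) (b := K)).exists_bound_of_continuousOn
    Real.continuous_mul_log.continuousOn
  have h_int : Integrable (fun p => ρ p * Real.log (ρ p)) sphereMeasure :=
    Integrable.of_bound (C := B) (hmeas.mul hmeas.log).aestronglyMeasurable
      (Filter.Eventually.of_forall fun p => hB _ ⟨h0 p, hK p⟩)
  refine ⟨h_int, (integral_mono h_int (hρ.mul_const (Real.log K)) fun p => ?_).trans_eq ?_⟩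
  · rcases (h0 p).eq_or_lt with h | h
    · simp [← h]
    · exact mul_le_mul_of_nonneg_left (Real.log_le_log h (hK p)) h.le
  · rw [integral_mul_const, h1, one_mul]

lemma le_prod_two_mul_sqrt {μ : Fin 3 → ℝ} {m : ℝ} (hm : 0 < m) (hμ : ∀ k, m ≤ μ k)
    (hsum : ∑ k, μ k = 1) : m ≤ ∏ k, (2 * √(3 * μ k)) := by
  rw [Fin.sum_univ_three] at hsum
  have hprod : m ^ 2 / 3 ≤ μ 0 * μ 1 * μ 2 := by
    have h01 : m ^ 2 ≤ μ 0 * μ 1 := by nlinarith [hμ 0, hμ 1]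
    have h02 : m ^ 2 ≤ μ 0 * μ 2 := by nlinarith [hμ 0, hμ 2]
    have h12 : m ^ 2 ≤ μ 1 * μ 2 := by nlinarith [hμ 1, hμ 2]
    have hm2 : 0 < m ^ 2 := by positivity
    rcases le_or_gt (1 / 3) (μ 0) with h | h
    · nlinarith
    rcases le_or_gt (1 / 3) (μ 1) with h' | h'
    · nlinarith
    have h'' : 1 / 3 ≤ μ 2 := by linarith
    nlinarith
  refine (sq_le_sq₀ hm.le (by positivity)).1 ?_
  have hs : ∀ k, √(3 * μ k) ^ 2 = 3 * μ k := fun k => Real.sq_sqrt (by linarith [hμ k])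
  rw [Fin.prod_univ_three, mul_pow, mul_pow, mul_pow, mul_pow, mul_pow, hs, hs, hs]
  nlinarith [sq_nonneg m]

lemma exists_entropy_le {Q : Matrix (Fin 3) (Fin 3) ℝ} (hQ : Q.IsHermitian)
    (htr : Q.trace = 0) {m : ℝ} (hm : 0 < m) (hle : ∀ k, m ≤ hQ.eigenvalues k + 1 / 3) :
    ∃ r ∈ admissibleEntropies Q, r ≤ Real.log 36 - Real.log m := by
  set b := hQ.eigenvectorBasis
  let μ : Fin 3 → ℝ := fun k => hQ.eigenvalues k + 1 / 3
  let a : Fin 3 → ℝ := fun k => √(3 * μ k)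
  have ha : ∀ k, 0 < a k := fun k => Real.sqrt_pos.2 (by have : m ≤ μ k := hle k; linarith)
  have hasq : ∀ k, a k ^ 2 = 3 * μ k := fun k =>
    Real.sq_sqrt (by have : m ≤ μ k := hle k; linarith)
  have hsum : ∑ k, μ k = 1 := by
    have h := hQ.trace_eq_sum_eigenvalues
    rw [htr] at h
    simp only [RCLike.ofReal_real_eq_id, id_eq] at h
    simp only [μ, Finset.sum_add_distrib, ← h]
    simp
  set ρ := radialDensity (boxDensity b a)
  have hmeas : Measurable ρ := measurable_radialDensity (measurable_boxDensity b)
  have h0 : ∀ p, 0 ≤ ρ p := radialDensity_nonneg (boxDensity_nonneg b ha)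
  have hK : ∀ p, ρ p ≤ 36 / m := fun p => by
    refine (radialDensity_le (boxDensity_nonneg b ha) (boxDensity_le b ha)
      (fun x hx => boxDensity_eq_zero b (lt_of_le_of_lt (le_of_eq ?_) hx)) p).trans ?_
    · simp only [hasq, ← Finset.mul_sum, hsum, mul_one]
    · rw [div_eq_mul_inv, Finset.prod_inv_distrib]
      gcongr
      exact le_prod_two_mul_sqrt hm hle hsum
  have hρ : Integrable ρ sphereMeasure :=
    Integrable.of_bound (C := 36 / m) hmeas.aestronglyMeasurable
      (Filter.Eventually.of_forall fun p => by rw [Real.norm_of_nonneg (h0 p)]; exact hK p)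
  have hmom : ∀ i j, ∫ p : sphere (0 : EuclideanSpace ℝ (Fin 3)) 1,
      (p : EuclideanSpace ℝ (Fin 3)) i * (p : EuclideanSpace ℝ (Fin 3)) j * ρ p ∂sphereMeasure =
      Q i j + if i = j then (1 / 3 : ℝ) else 0 := fun i j => by
    rw [integral_mul_radialDensity i j (integrable_mul_boxDensity b i j),
      integral_mul_boxDensity b ha, apply_eq_sum_eigenvalues hQ i j]
    have hδ := sum_eigenvectorBasis_mul b i j
    have : (if i = j then (1 / 3 : ℝ) else 0) = 1 / 3 * ∑ k, b k i * b k j := by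
      rw [hδ]; split_ifs <;> simp
    rw [this, Finset.mul_sum, ← Finset.sum_add_distrib]
    refine Finset.sum_congr rfl fun k _ => ?_
    rw [hasq]
    simp only [μ]
    ring
  have hmint : ∀ i j, Integrable (fun p : sphere (0 : EuclideanSpace ℝ (Fin 3)) 1 =>
      (p : EuclideanSpace ℝ (Fin 3)) i * (p : EuclideanSpace ℝ (Fin 3)) j * ρ p)
      sphereMeasure := fun i j => by
    convert! (integrable_qTensor_mul hρ i j).add
      (hρ.const_mul (if i = j then (1 / 3 : ℝ) else 0)) using 2 with p
    simp only [Pi.add_apply]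
    ring
  have h1 : ∫ p, ρ p ∂sphereMeasure = 1 := by
    have hpt : ∀ p : sphere (0 : EuclideanSpace ℝ (Fin 3)) 1, ρ p = ∑ i,
        (p : EuclideanSpace ℝ (Fin 3)) i * (p : EuclideanSpace ℝ (Fin 3)) i * ρ p := fun p => by
      rw [← Finset.sum_mul]
      simp only [← pow_two, sphere_sum_sq, one_mul]
    rw [integral_congr_ae (Filter.Eventually.of_forall hpt),
      integral_finsetSum _ fun i _ => hmint i i]
    simp only [hmom, if_true, Finset.sum_add_distrib]
    have : ∑ i, Q i i = 0 := htr
    rw [this]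
    simp
  obtain ⟨hent, hent_le⟩ := entropy_of_bounded hmeas h0 hK h1
  refine ⟨_, ⟨ρ, hmeas, Filter.Eventually.of_forall h0, Filter.Eventually.of_forall fun p => ?_,
    hρ, h1, hent, fun i j => ?_, rfl⟩, hent_le.trans_eq (Real.log_div (by norm_num) hm.ne')⟩
  · simp only [ρ, radialDensity, coe_neg_sphere, smul_neg, boxDensity_neg]
  · simp only [sub_mul]
    rw [integral_sub (hmint i j) (hρ.const_mul _), hmom, integral_const_mul, h1]
    ring

/-- Logarithmic bounds on the Ball–Majumdar singular bulk potential: there are constants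
`C₁, C₂` such that for every symmetric traceless `Q` with `λ_min(Q) > −1/3` the infimum
`f(Q)` is finite and `C₁ − (1/2)ln(λ_min(Q) + 1/3) ≤ f(Q) ≤ C₂ − ln(λ_min(Q) + 1/3)`. -/
theorem singular_potential_log_bounds :
    ∃ C₁ C₂ : ℝ, ∀ (Q : Matrix (Fin 3) (Fin 3) ℝ) (hQ : Q.IsHermitian),
      Q.trace = 0 → -(1/3 : ℝ) < ⨅ i, hQ.eigenvalues i →
      (admissibleEntropies Q).Nonempty ∧ BddBelow (admissibleEntropies Q) ∧
      C₁ - (1/2 : ℝ) * Real.log ((⨅ i, hQ.eigenvalues i) + 1/3) ≤ singularPotential Q ∧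
      singularPotential Q ≤ C₂ - Real.log ((⨅ i, hQ.eigenvalues i) + 1/3) := by
  obtain ⟨C₁, hC₁⟩ := entropy_lower_bound
  refine ⟨C₁, Real.log 36, fun Q hQ htr hmin => ?_⟩
  obtain ⟨k, hk⟩ := exists_eq_ciInf_of_finite (f := hQ.eigenvalues)
  have hpos : 0 < (⨅ i, hQ.eigenvalues i) + 1 / 3 := by linarith
  obtain ⟨r, hr, hrle⟩ := exists_entropy_le hQ htr hpos fun l => by
    gcongr
    exact ciInf_le (Set.finite_range _).bddBelow l
  have hlow := hC₁ hQ k (by rwa [hk])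
  rw [hk] at hlow
  have hbdd : BddBelow (admissibleEntropies Q) := ⟨_, hlow⟩
  exact ⟨⟨r, hr⟩, hbdd, le_csInf ⟨r, hr⟩ hlow, (csInf_le hbdd hr).trans hrle⟩
end
end

section
/- Let l₁, l₂, d > 0, Ω = (0,l₁) × (0,l₂) × (0,d), and let α, β ∈ ℝ with |β − α| ≤ π/2. Set n₀ = (cos α, sin α, 0) and n_d = (cos β, sin β, 0). Let K₁, K₂, K₃, K₄ ∈ ℝ with 0 < K₂ ≤ min(K₁, K₃), and let W(n,∇n) = K₁(div n)² + K₂(n·curl n)² + K₃|n ∧ curl n|² + (K₂+K₄)(tr(∇n)² − (div n)²) be the Oseen-Frank density. Let n : ℝ³ → S² be twice continuously differentiable, periodic with period l₁ in x₁ and period l₂ in x₂, and satisfy n(x₁,x₂,0) = n₀ and n(x₁,x₂,d) = n_d for all (x₁,x₂). Then ∫_Ω W(n,∇n) dx ≥ K₂ l₁ l₂ (β − α)²/d, and equality holds for the pure twist n*(x) = (cos θ(x₃), sin θ(x₃), 0) with θ(x₃) = α + (β − α)x₃/d. -/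
open scoped BigOperators
open MeasureTheory Set

noncomputable section

/-- The Oseen-Frank energy density evaluated algebraically at director `n`
and gradient matrix `A`:
`W(n,A) = K₁(div n)² + K₂(n·curl n)² + K₃|n ∧ curl n|² + (K₂+K₄)(tr(∇n)² − (div n)²)`. -/
def OseenFrankDensityAlg (K₁ K₂ K₃ K₄ : ℝ) (n : Fin 3 → ℝ)
    (A : Matrix (Fin 3) (Fin 3) ℝ) : ℝ :=
  K₁ * (Matrix.trace A) ^ 2 + K₂ * (∑ i, n i * axialVec A i) ^ 2 +
    K₃ * (∑ i, cross3 n (axialVec A) i ^ 2) +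
    (K₂ + K₄) * (Matrix.trace (A * A) - (Matrix.trace A) ^ 2)

/-- The gradient matrix `(∇n)_{ij} = n_{i,j}` of a vector field `n : ℝ³ → ℝ³`. -/
def gradMat (n : (Fin 3 → ℝ) → Fin 3 → ℝ) (x : Fin 3 → ℝ) :
    Matrix (Fin 3) (Fin 3) ℝ :=
  Matrix.of fun i j => fderiv ℝ (fun y => n y i) x (Pi.single j 1)

/-- The Oseen-Frank energy density `W(n,∇n)` of a director field. -/
def OFdensity (K₁ K₂ K₃ K₄ : ℝ) (n : (Fin 3 → ℝ) → Fin 3 → ℝ) (x : Fin 3 → ℝ) : ℝ :=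
  OseenFrankDensityAlg K₁ K₂ K₃ K₄ (n x) (gradMat n x)

/-- The integral over a box of the divergence of a `C¹` vector field vanishes when the normal
components agree on each pair of opposite faces. -/
theorem setIntegral_divergence_eq_zero {m : ℕ} {l : Fin (m + 1) → ℝ} (hl : 0 ≤ l)
    (F : Fin (m + 1) → (Fin (m + 1) → ℝ) → ℝ)
    (hF : ∀ i, ∀ x ∈ Icc 0 l, ContDiffAt ℝ 1 (F i) x)
    (hface : ∀ i x, x i = 0 → F i (x + l i • Pi.single i 1) = F i x) :
    IntegrableOn (fun x => ∑ i, fderiv ℝ (F i) x (Pi.single i 1)) (Icc 0 l) ∧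
      ∫ x in Icc 0 l, ∑ i, fderiv ℝ (F i) x (Pi.single i 1) = 0 := by
  have hint : IntegrableOn (fun x => ∑ i, fderiv ℝ (F i) x (Pi.single i 1)) (Icc 0 l) := by
    refine ContinuousOn.integrableOn_compact isCompact_Icc ?_
    refine continuousOn_finsetSum _ fun i _ x hx => ContinuousAt.continuousWithinAt ?_
    exact ((hF i x hx).continuousAt_fderiv one_ne_zero).clm_apply continuousAt_const
  refine ⟨hint, ?_⟩
  rw [integral_divergence_of_hasFDerivAt_off_countable' 0 l hl F (fun i => fderiv ℝ (F i)) ∅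
    countable_empty (fun i x hx => (hF i x hx).continuousAt.continuousWithinAt)
    (fun x hx i => ((hF i x ?_).differentiableAt one_ne_zero).hasFDerivAt) hint]
  · refine Finset.sum_eq_zero fun i _ => sub_eq_zero.2 ?_
    refine integral_congr_ae (Filter.Eventually.of_forall fun x => ?_)
    have key : i.insertNth (l i) x =
        (i.insertNth 0 x : Fin (m + 1) → ℝ) + l i • Pi.single i 1 := by
      refine Fin.insertNth_eq_iff.2 ⟨by simp, ?_⟩
      ext j
      simp [Fin.removeNth]
    simpa [key] using hface i (i.insertNth 0 x) (by simp)
  · exact ⟨fun i => (hx.1 i trivial).1.le, fun i => (hx.1 i trivial).2.le⟩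

/-- The squared Frobenius norm of `A`, plus a null Lagrangian, bounds the Oseen-Frank density
from below when `K₂` is the smallest of the bulk constants. -/
theorem le_OseenFrankDensityAlg {K₁ K₂ K₃ : ℝ} (K₄ : ℝ) (hK₁ : K₂ ≤ K₁) (hK₃ : K₂ ≤ K₃)
    {n : Fin 3 → ℝ} (hn : ∑ i, n i ^ 2 = 1) (A : Matrix (Fin 3) (Fin 3) ℝ) :
    K₂ * ∑ i, ∑ j, A i j ^ 2 + K₄ * (Matrix.trace (A * A) - Matrix.trace A ^ 2) ≤
      OseenFrankDensityAlg K₁ K₂ K₃ K₄ n A := by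
  have hcurl : ∑ i, cross3 n (axialVec A) i ^ 2 =
      ∑ i, axialVec A i ^ 2 - (∑ i, n i * axialVec A i) ^ 2 := by
    generalize axialVec A = c
    simp only [Fin.sum_univ_three] at hn
    simp only [cross3, levicivita, Fin.sum_univ_three]
    norm_num
    linear_combination (c 0 ^ 2 + c 1 ^ 2 + c 2 ^ 2) * hn
  have hfrob : ∑ i, ∑ j, A i j ^ 2 = Matrix.trace (A * A) + ∑ i, axialVec A i ^ 2 := by
    simp only [axialVec, levicivita, Fin.sum_univ_three, Matrix.trace, Matrix.diag_apply,
      Matrix.mul_apply]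
    norm_num
    ring
  have h₁ := mul_nonneg (sub_nonneg.2 hK₁) (sq_nonneg (Matrix.trace A))
  have h₃ := mul_nonneg (sub_nonneg.2 hK₃)
    (Finset.sum_nonneg fun i (_ : i ∈ Finset.univ) => sq_nonneg (cross3 n (axialVec A) i))
  rw [OseenFrankDensityAlg, hfrob]
  linear_combination h₁ + h₃ - K₂ * hcurl

theorem box_ae_eq_Icc (l₁ l₂ d : ℝ) : box l₁ l₂ d =ᵐ[volume] Icc 0 ![l₁, l₂, d] := by
  have h : box l₁ l₂ d = Set.pi univ fun i => Ioo ((0 : Fin 3 → ℝ) i) (![l₁, l₂, d] i) := by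
    ext x
    simp [box, Fin.forall_fin_succ]
  rw [h]
  exact Measure.univ_pi_Ioo_ae_eq_Icc

theorem volume_real_box {l₁ l₂ d : ℝ} (hl₁ : 0 ≤ l₁) (hl₂ : 0 ≤ l₂) (hd : 0 ≤ d) :
    volume.real (box l₁ l₂ d) = l₁ * l₂ * d := by
  rw [measureReal_congr (box_ae_eq_Icc l₁ l₂ d), measureReal_def, Real.volume_Icc_pi_toReal]
  · simp [Fin.prod_univ_three]
  · intro i
    fin_cases i <;> simpa

section GradMat

variable {n : (Fin 3 → ℝ) → Fin 3 → ℝ}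

theorem contDiff_gradMat (hn : ContDiff ℝ 2 n) (i j : Fin 3) :
    ContDiff ℝ 1 fun x => gradMat n x i j :=
  ((contDiff_pi.1 hn i).fderiv_right (m := 1) (by norm_num)).clm_apply contDiff_const

theorem gradMat_add {v : Fin 3 → ℝ} (hper : ∀ x, n (x + v) = n x) (x : Fin 3 → ℝ) :
    gradMat n (x + v) = gradMat n x := by
  ext i j
  simp only [gradMat, Matrix.of_apply]
  rw [← fderiv_comp_add_right]
  simp only [hper]

theorem gradMat_eq_zero (hn : ContDiff ℝ 2 n) {x : Fin 3 → ℝ} {j : Fin 3}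
    (h : ∀ t : ℝ, n (x + t • Pi.single j 1) = n x) (i : Fin 3) : gradMat n x i j = 0 := by
  have hd : DifferentiableAt ℝ (fun y => n y i) x :=
    (contDiff_pi.1 hn i).differentiable two_ne_zero x
  simp only [gradMat, Matrix.of_apply]
  rw [← hd.lineDeriv_eq_fderiv, lineDeriv]
  simp [h]

theorem sum_mul_gradMat_eq_zero (hn : ContDiff ℝ 2 n) (hunit : ∀ x, ∑ i, n x i ^ 2 = 1)
    (x : Fin 3 → ℝ) (j : Fin 3) : ∑ i, n x i * gradMat n x i j = 0 := by
  have hd : ∀ i, HasFDerivAt (fun y => n y i) (fderiv ℝ (fun y => n y i) x) x := fun i =>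
    ((contDiff_pi.1 hn i).differentiable two_ne_zero x).hasFDerivAt
  have hsum := HasFDerivAt.fun_sum (u := Finset.univ) fun i _ => (hd i).pow 2
  simp only [hunit] at hsum
  have := congrArg (fun L => L (Pi.single j 1)) (hsum.unique (hasFDerivAt_const (1 : ℝ) x))
  simp [mul_assoc, ← Finset.mul_sum] at this
  simpa [gradMat] using this

/-- The vector field `(n · ∇) n - (div n) n`, whose divergence is the saddle-splay density. -/
def saddleSplayField (n : (Fin 3 → ℝ) → Fin 3 → ℝ) (j : Fin 3) (x : Fin 3 → ℝ) : ℝ :=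
  ∑ i, (n x i * gradMat n x j i - n x j * gradMat n x i i)

theorem contDiff_saddleSplayField (hn : ContDiff ℝ 2 n) (j : Fin 3) :
    ContDiff ℝ 1 (saddleSplayField n j) := by
  have h₀ : ∀ i, ContDiff ℝ 1 fun x => n x i := fun i =>
    (contDiff_pi.1 hn i).of_le (by norm_num)
  exact ContDiff.sum fun i _ => ((h₀ i).mul (contDiff_gradMat hn j i)).sub
    ((h₀ j).mul (contDiff_gradMat hn i i))

theorem fderiv_gradMat_comm (hn : ContDiff ℝ 2 n) (x : Fin 3 → ℝ) (i j k : Fin 3) :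
    fderiv ℝ (fun y => gradMat n y i j) x (Pi.single k 1) =
      fderiv ℝ (fun y => gradMat n y i k) x (Pi.single j 1) := by
  have hC := contDiff_pi.1 hn i
  have hd : DifferentiableAt ℝ (fderiv ℝ fun y => n y i) x :=
    (hC.fderiv_right (m := 1) (by norm_num)).differentiable one_ne_zero x
  have hsymm : IsSymmSndFDerivAt ℝ (fun y => n y i) x :=
    hC.contDiffAt.isSymmSndFDerivAt (by simp)
  simp only [gradMat, Matrix.of_apply]
  rw [fderiv_clm_apply hd (by fun_prop), fderiv_clm_apply hd (by fun_prop)]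
  simpa using hsymm.eq _ _

theorem sum_fderiv_saddleSplayField (hn : ContDiff ℝ 2 n) (x : Fin 3 → ℝ) :
    ∑ j, fderiv ℝ (saddleSplayField n j) x (Pi.single j 1) =
      Matrix.trace (gradMat n x * gradMat n x) - Matrix.trace (gradMat n x) ^ 2 := by
  have hd : ∀ i, HasFDerivAt (fun y => n y i) (fderiv ℝ (fun y => n y i) x) x := fun i =>
    ((contDiff_pi.1 hn i).differentiable two_ne_zero x).hasFDerivAt
  have hg : ∀ i j, HasFDerivAt (fun y => gradMat n y i j)
      (fderiv ℝ (fun y => gradMat n y i j) x) x := fun i j =>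
    ((contDiff_gradMat hn i j).differentiable one_ne_zero x).hasFDerivAt
  have hF : ∀ j, fderiv ℝ (saddleSplayField n j) x (Pi.single j 1) =
      ∑ i, (n x i * fderiv ℝ (fun y => gradMat n y j i) x (Pi.single j 1) +
          gradMat n x j i * gradMat n x i j -
        (n x j * fderiv ℝ (fun y => gradMat n y i i) x (Pi.single j 1) +
          gradMat n x i i * gradMat n x j j)) := by
    intro j
    have h := HasFDerivAt.fun_sum (u := Finset.univ) fun i _ =>
      ((hd i).mul (hg j i)).sub ((hd j).mul (hg i i))
    have h' : HasFDerivAt (saddleSplayField n j) _ x := h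
    rw [h'.fderiv]
    simp [gradMat]
  simp only [hF, Fin.sum_univ_three, Matrix.trace, Matrix.diag_apply, Matrix.mul_apply]
  rw [fderiv_gradMat_comm hn x 0 1 0, fderiv_gradMat_comm hn x 0 2 0,
    fderiv_gradMat_comm hn x 1 0 1, fderiv_gradMat_comm hn x 1 2 1,
    fderiv_gradMat_comm hn x 2 0 2, fderiv_gradMat_comm hn x 2 1 2]
  ring

/-- The saddle-splay energy over a period cell vanishes for a laterally periodic field which is
constant and planar on each of the two plates. -/
theorem setIntegral_saddleSplay_eq_zero {l₁ l₂ d : ℝ} (hl : 0 ≤ ![l₁, l₂, d])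
    (hn : ContDiff ℝ 2 n)
    (hper₁ : ∀ x, n (x + l₁ • ((Pi.single 0 1 : Fin 3 → ℝ))) = n x)
    (hper₂ : ∀ x, n (x + l₂ • ((Pi.single 1 1 : Fin 3 → ℝ))) = n x)
    {u v : Fin 3 → ℝ} (hu : u 2 = 0) (hv : v 2 = 0)
    (hbot : ∀ x, x 2 = 0 → n x = u) (htop : ∀ x, x 2 = d → n x = v) :
    IntegrableOn (fun x => Matrix.trace (gradMat n x * gradMat n x) -
        Matrix.trace (gradMat n x) ^ 2) (Icc 0 ![l₁, l₂, d]) ∧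
      ∫ x in Icc 0 ![l₁, l₂, d], (Matrix.trace (gradMat n x * gradMat n x) -
        Matrix.trace (gradMat n x) ^ 2) = 0 := by
  have hplate : ∀ (c : ℝ) (w : Fin 3 → ℝ), w 2 = 0 → (∀ x, x 2 = c → n x = w) →
      ∀ x, x 2 = c → saddleSplayField n 2 x = 0 := by
    intro c w hw hc x hx
    have hx2 : n x 2 = 0 := by rw [hc x hx, hw]
    have h₀ : gradMat n x 2 0 = 0 := gradMat_eq_zero hn (fun t => by
      rw [hc x hx, hc _ (by simp [hx])]) 2
    have h₁ : gradMat n x 2 1 = 0 := gradMat_eq_zero hn (fun t => by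
      rw [hc x hx, hc _ (by simp [hx])]) 2
    simp [saddleSplayField, Fin.sum_univ_three, hx2, h₀, h₁]
  simp only [← sum_fderiv_saddleSplayField hn]
  refine setIntegral_divergence_eq_zero hl _
    (fun i x _ => (contDiff_saddleSplayField hn i).contDiffAt) ?_
  intro i x hx
  fin_cases i
  · simp [saddleSplayField, hper₁, gradMat_add hper₁]
  · simp [saddleSplayField, hper₂, gradMat_add hper₂]
  · have h := hplate d v hv htop (x + d • Pi.single 2 1) (by simpa using hx)
    simpa [hplate 0 u hu hbot x hx] using h

end GradMat

/-- A pure twist with constant pitch `ω` and phase `α`. -/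
def twist (α ω : ℝ) (x : Fin 3 → ℝ) : Fin 3 → ℝ :=
  ![Real.cos (α + ω * x 2), Real.sin (α + ω * x 2), 0]

theorem OFdensity_twist (K₁ K₂ K₃ K₄ α ω : ℝ) (x : Fin 3 → ℝ) :
    OFdensity K₁ K₂ K₃ K₄ (twist α ω) x = K₂ * ω ^ 2 := by
  have hθ : HasFDerivAt (fun y : Fin 3 → ℝ => α + ω * y 2)
      (ω • ContinuousLinearMap.proj (R := ℝ) (φ := fun _ : Fin 3 => ℝ) 2) x :=
    ((hasFDerivAt_apply 2 x).const_mul ω).const_add α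
  have hgrad : gradMat (twist α ω) x =
      !![0, 0, -(Real.sin (α + ω * x 2) * ω); 0, 0, Real.cos (α + ω * x 2) * ω; 0, 0, 0] := by
    ext i j
    fin_cases i
    · simp only [gradMat, twist, Matrix.of_apply, Fin.zero_eta, Matrix.cons_val_zero]
      rw [hθ.cos.fderiv]
      fin_cases j <;> simp
    · simp only [gradMat, twist, Matrix.of_apply, Fin.mk_one, Matrix.cons_val_one,
        Matrix.cons_val_zero]
      rw [hθ.sin.fderiv]
      fin_cases j <;> simp
    · fin_cases j <;> simp [gradMat, twist]
  have hsc := Real.sin_sq_add_cos_sq (α + ω * x 2)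
  rw [OFdensity, hgrad, OseenFrankDensityAlg]
  simp only [twist, cross3, axialVec, levicivita, Matrix.trace, Matrix.diag_apply,
    Matrix.mul_apply, Fin.sum_univ_three, Matrix.of_apply, Matrix.cons_val]
  norm_num
  generalize Real.sin (α + ω * x 2) = s at *
  generalize Real.cos (α + ω * x 2) = c at *
  linear_combination (K₂ * ω ^ 2 * (s ^ 2 + c ^ 2 + 1)) * hsc

/-- The calibration certifying that the twist of pitch `ω` and phase `α` minimizes the one
constant energy in a slab of thickness `d`. With `u` the twist and `w = n - u`, it equals
`2 u' · w - τ |w|²`, where `τ = ω tan (ω (x₃ - d / 2))` solves `τ' = ω² + τ²`. -/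
def twistCalibration (α ω d : ℝ) (n : (Fin 3 → ℝ) → Fin 3 → ℝ) (x : Fin 3 → ℝ) : ℝ :=
  2 * ω * (Real.cos (α + ω * x 2) * n x 1 - Real.sin (α + ω * x 2) * n x 0 -
    Real.tan (ω * (x 2 - d / 2)) *
      (1 - (Real.cos (α + ω * x 2) * n x 0 + Real.sin (α + ω * x 2) * n x 1)))

theorem cos_ne_zero_of_abs_mul_le {ω d t : ℝ} (hω : |ω * d| ≤ Real.pi / 2) (ht : t ∈ Icc 0 d) :
    Real.cos (ω * (t - d / 2)) ≠ 0 := by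
  have hd : 0 ≤ d := ht.1.trans ht.2
  have h : |ω * (t - d / 2)| ≤ |ω * d| / 2 := by
    rw [abs_mul, abs_mul, abs_of_nonneg hd, mul_div_assoc]
    refine mul_le_mul_of_nonneg_left (abs_le.2 ⟨?_, ?_⟩) (abs_nonneg ω) <;>
      linarith [ht.1, ht.2]
  have hπ := Real.pi_pos
  have h' := abs_le.1 (h.trans (div_le_div_of_nonneg_right hω zero_le_two))
  exact (Real.cos_pos_of_mem_Ioo ⟨by linarith, by linarith⟩).ne'

section Calibration

variable {n : (Fin 3 → ℝ) → Fin 3 → ℝ} {α ω d : ℝ}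

theorem contDiffAt_twistCalibration (hn : ContDiff ℝ 2 n) {x : Fin 3 → ℝ}
    (hx : Real.cos (ω * (x 2 - d / 2)) ≠ 0) : ContDiffAt ℝ 1 (twistCalibration α ω d n) x := by
  have h₀ : ∀ i, ContDiffAt ℝ 1 (fun x => n x i) x := fun i =>
    ((contDiff_pi.1 hn i).of_le (by norm_num)).contDiffAt
  have h2 : ContDiffAt ℝ 1 (fun y : Fin 3 → ℝ => y 2) x := (contDiff_apply ℝ ℝ 2).contDiffAt
  have hθ : ContDiffAt ℝ 1 (fun y : Fin 3 → ℝ => α + ω * y 2) x :=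
    contDiffAt_const.add (contDiffAt_const.mul h2)
  have hT : ContDiffAt ℝ 1 (fun y : Fin 3 → ℝ => Real.tan (ω * (y 2 - d / 2))) x :=
    ContDiffAt.comp (g := Real.tan) x (Real.contDiffAt_tan.2 hx)
      (contDiffAt_const.mul (h2.sub contDiffAt_const))
  exact contDiffAt_const.mul (((hθ.cos.mul (h₀ 1)).sub (hθ.sin.mul (h₀ 0))).sub
    (hT.mul (contDiffAt_const.sub ((hθ.cos.mul (h₀ 0)).add (hθ.sin.mul (h₀ 1))))))

theorem sq_add_fderiv_twistCalibration_le (hn : ContDiff ℝ 2 n)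
    (hunit : ∀ x, ∑ i, n x i ^ 2 = 1) {x : Fin 3 → ℝ}
    (hx : Real.cos (ω * (x 2 - d / 2)) ≠ 0) :
    ω ^ 2 + fderiv ℝ (twistCalibration α ω d n) x (Pi.single 2 1) ≤
      ∑ i, gradMat n x i 2 ^ 2 := by
  have hd : ∀ i, HasFDerivAt (fun y => n y i) (fderiv ℝ (fun y => n y i) x) x := fun i =>
    ((contDiff_pi.1 hn i).differentiable two_ne_zero x).hasFDerivAt
  have h2 : HasFDerivAt (fun y : Fin 3 → ℝ => y 2)
    (ContinuousLinearMap.proj (R := ℝ) (φ := fun _ : Fin 3 => ℝ) 2) x := hasFDerivAt_apply 2 x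
  have hθ := (h2.const_mul ω).const_add α
  have hT := (Real.hasDerivAt_tan hx).comp_hasFDerivAt x ((h2.sub_const (d / 2)).const_mul ω)
  have hG : HasFDerivAt (twistCalibration α ω d n) _ x :=
    (((hθ.cos.mul (hd 1)).sub (hθ.sin.mul (hd 0))).sub
      (hT.mul (((hθ.cos.mul (hd 0)).add (hθ.sin.mul (hd 1))).const_sub 1))).const_mul (2 * ω)
  have hsec : 1 / Real.cos (ω * (x 2 - d / 2)) ^ 2 = 1 + Real.tan (ω * (x 2 - d / 2)) ^ 2 := by
    rw [one_div, ← Real.inv_one_add_tan_sq hx, inv_inv]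
  have hval : fderiv ℝ (twistCalibration α ω d n) x (Pi.single 2 1) =
      2 * ω * (Real.cos (α + ω * x 2) * (gradMat n x 1 2 - ω * n x 0) -
        Real.sin (α + ω * x 2) * (gradMat n x 0 2 + ω * n x 1) -
        ω * (1 + Real.tan (ω * (x 2 - d / 2)) ^ 2) *
          (1 - (Real.cos (α + ω * x 2) * n x 0 + Real.sin (α + ω * x 2) * n x 1)) +
        Real.tan (ω * (x 2 - d / 2)) *
          (Real.cos (α + ω * x 2) * (gradMat n x 0 2 + ω * n x 1) +
            Real.sin (α + ω * x 2) * (gradMat n x 1 2 - ω * n x 0))) := by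
    rw [hG.fderiv, ← hsec]
    simp [gradMat]
    exact Or.inl (by ring)
  have hu := hunit x
  have horth := sum_mul_gradMat_eq_zero hn hunit x 2
  have hsc := Real.sin_sq_add_cos_sq (α + ω * x 2)
  simp only [Fin.sum_univ_three] at hu horth ⊢
  rw [hval]
  generalize Real.sin (α + ω * x 2) = s at *
  generalize Real.cos (α + ω * x 2) = c at *
  generalize Real.tan (ω * (x 2 - d / 2)) = T at *
  generalize gradMat n x 0 2 = p at *
  generalize gradMat n x 1 2 = q at *
  generalize gradMat n x 2 2 = r at *
  generalize n x 0 = a at *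
  generalize n x 1 = b at *
  generalize n x 2 = e at *
  have hsq := add_nonneg (add_nonneg (sq_nonneg (p + ω * s + ω * T * (a - c)))
    (sq_nonneg (q - ω * c + ω * T * (b - s)))) (sq_nonneg (r + ω * T * e))
  linear_combination hsq + (2 * ω * T) * horth + (ω ^ 2 * T ^ 2) * hu +
    (ω ^ 2 + ω ^ 2 * T ^ 2) * hsc

theorem setIntegral_fderiv_twistCalibration {l₁ l₂ : ℝ} (hl : 0 ≤ ![l₁, l₂, d])
    (hn : ContDiff ℝ 2 n)
    (hcos : ∀ x ∈ Icc 0 ![l₁, l₂, d], Real.cos (ω * (x 2 - d / 2)) ≠ 0)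
    (hbot : ∀ x, x 2 = 0 → n x = ![Real.cos α, Real.sin α, 0])
    (htop : ∀ x, x 2 = d → n x = ![Real.cos (α + ω * d), Real.sin (α + ω * d), 0]) :
    IntegrableOn (fun x => fderiv ℝ (twistCalibration α ω d n) x (Pi.single 2 1))
        (Icc 0 ![l₁, l₂, d]) ∧
      ∫ x in Icc 0 ![l₁, l₂, d],
        fderiv ℝ (twistCalibration α ω d n) x (Pi.single 2 1) = 0 := by
  have hplate : ∀ x, n x = twist α ω x → twistCalibration α ω d n x = 0 := by
    intro x hx
    have hsc := Real.sin_sq_add_cos_sq (α + ω * x 2)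
    simp only [twistCalibration, hx, twist, Matrix.cons_val_zero, Matrix.cons_val_one]
    linear_combination 2 * ω * Real.tan (ω * (x 2 - d / 2)) * hsc
  have hdiv : ∀ x, fderiv ℝ (twistCalibration α ω d n) x (Pi.single 2 1) =
      ∑ i, fderiv ℝ (![0, 0, twistCalibration α ω d n] i) x (Pi.single i 1) := by
    intro x
    simp [Fin.sum_univ_three]
  simp only [hdiv]
  refine setIntegral_divergence_eq_zero hl _ ?_ ?_
  · intro i x hx
    fin_cases i
    · exact contDiffAt_const
    · exact contDiffAt_const
    · exact contDiffAt_twistCalibration hn (hcos x hx)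
  · intro i x hx
    fin_cases i
    · rfl
    · rfl
    · have hx' : x 2 = 0 := hx
      have h₁ := hplate x (by simp [hbot x hx', twist, hx'])
      have h₂ := hplate (x + d • Pi.single 2 1)
        (by rw [htop _ (by simp [hx'])]; simp [twist, hx'])
      exact h₂.trans h₁.symm

end Calibration

theorem continuous_OFdensity {K₁ K₂ K₃ K₄ : ℝ} {n : (Fin 3 → ℝ) → Fin 3 → ℝ}
    (hn : ContDiff ℝ 2 n) : Continuous (OFdensity K₁ K₂ K₃ K₄ n) := by
  have h₀ : ∀ i, Continuous fun x => n x i := fun i => (contDiff_pi.1 hn i).continuous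
  have h₁ : ∀ i j, Continuous fun x => gradMat n x i j := fun i j =>
    (contDiff_gradMat hn i j).continuous
  unfold OFdensity OseenFrankDensityAlg cross3 axialVec Matrix.trace
  simp only [Matrix.diag_apply, Matrix.mul_apply]
  fun_prop

/-- Pure twists minimize the Oseen-Frank energy between parallel plates with planar
boundary conditions when `0 < K₂ ≤ min(K₁,K₃)`: any smooth laterally periodic unit
vector field matching the planar boundary data has energy at least
`K₂ l₁ l₂ (β−α)²/d`, with equality for the pure twist
`n*(x) = (cos θ(x₃), sin θ(x₃), 0)`, `θ(x₃) = α + (β−α)x₃/d`. -/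
theorem pure_twist_minimizes (l₁ l₂ d α β K₁ K₂ K₃ K₄ : ℝ)
    (hl₁ : 0 < l₁) (hl₂ : 0 < l₂) (hd : 0 < d)
    (hαβ : |β - α| ≤ Real.pi / 2)
    (hK₂ : 0 < K₂) (hK₁ : K₂ ≤ K₁) (hK₃ : K₂ ≤ K₃)
    (n : (Fin 3 → ℝ) → Fin 3 → ℝ) (hn : ContDiff ℝ 2 n)
    (hunit : ∀ x, ∑ i, n x i ^ 2 = 1)
    (hper₁ : ∀ x, n (x + l₁ • ((Pi.single 0 1 : Fin 3 → ℝ))) = n x)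
    (hper₂ : ∀ x, n (x + l₂ • ((Pi.single 1 1 : Fin 3 → ℝ))) = n x)
    (hbot : ∀ x₁ x₂ : ℝ, n ![x₁, x₂, 0] = ![Real.cos α, Real.sin α, 0])
    (htop : ∀ x₁ x₂ : ℝ, n ![x₁, x₂, d] = ![Real.cos β, Real.sin β, 0]) :
    K₂ * l₁ * l₂ * (β - α) ^ 2 / d ≤
        (∫ x in box l₁ l₂ d, OFdensity K₁ K₂ K₃ K₄ n x) ∧
      (∫ x in box l₁ l₂ d, OFdensity K₁ K₂ K₃ K₄
          (fun x => ![Real.cos (α + (β - α) * x 2 / d),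
            Real.sin (α + (β - α) * x 2 / d), 0]) x) =
        K₂ * l₁ * l₂ * (β - α) ^ 2 / d := by
  have hl : 0 ≤ ![l₁, l₂, d] := by
    intro i
    fin_cases i <;> simp [hl₁.le, hl₂.le, hd.le]
  set ω := (β - α) / d with hω
  have hωd : ω * d = β - α := div_mul_cancel₀ _ hd.ne'
  have hvol : volume.real (Icc 0 ![l₁, l₂, d]) = l₁ * l₂ * d := by
    rw [← measureReal_congr (box_ae_eq_Icc l₁ l₂ d), volume_real_box hl₁.le hl₂.le hd.le]
  have henergy : l₁ * l₂ * d * (K₂ * ω ^ 2) = K₂ * l₁ * l₂ * (β - α) ^ 2 / d := by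
    rw [hω]
    field_simp
  constructor
  · have hbot' : ∀ x, x 2 = 0 → n x = ![Real.cos α, Real.sin α, 0] := fun x hx => by
      rw [← hbot (x 0) (x 1), ← hx]
      congr 1
      ext i
      fin_cases i <;> rfl
    have htop' : ∀ x, x 2 = d → n x = ![Real.cos β, Real.sin β, 0] := fun x hx => by
      rw [← htop (x 0) (x 1), ← hx]
      congr 1
      ext i
      fin_cases i <;> rfl
    have hcos : ∀ x ∈ Icc 0 ![l₁, l₂, d], Real.cos (ω * (x 2 - d / 2)) ≠ 0 := fun x hx =>
      cos_ne_zero_of_abs_mul_le (hωd.symm ▸ hαβ) ⟨hx.1 2, hx.2 2⟩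
    obtain ⟨hSint, hS⟩ := setIntegral_saddleSplay_eq_zero hl hn hper₁ hper₂ rfl rfl hbot' htop'
    obtain ⟨hGint, hG⟩ := setIntegral_fderiv_twistCalibration hl hn hcos hbot'
      (hωd.symm ▸ (add_sub_cancel α β).symm ▸ htop')
    have hWint : IntegrableOn (OFdensity K₁ K₂ K₃ K₄ n) (Icc 0 ![l₁, l₂, d]) :=
      (continuous_OFdensity hn).continuousOn.integrableOn_compact isCompact_Icc
    have hcint : IntegrableOn (fun _ : Fin 3 → ℝ => K₂ * ω ^ 2) (Icc 0 ![l₁, l₂, d]) :=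
      continuousOn_const.integrableOn_compact isCompact_Icc
    rw [setIntegral_congr_set (box_ae_eq_Icc l₁ l₂ d)]
    have hmono := setIntegral_mono_on
      ((hcint.add (hGint.const_mul K₂)).add (hSint.const_mul K₄)) hWint measurableSet_Icc
      fun x hx => ?_
    · rw [integral_add' (hcint.add (hGint.const_mul K₂)) (hSint.const_mul K₄),
        integral_add' hcint (hGint.const_mul K₂), setIntegral_const, hvol, smul_eq_mul, henergy,
        integral_const_mul, integral_const_mul, hG, hS] at hmono
      simpa using hmono
    · have h₁ := mul_le_mul_of_nonneg_left
        ((sq_add_fderiv_twistCalibration_le (α := α) hn hunit (hcos x hx)).trans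
          (Finset.sum_le_sum fun i _ => Finset.single_le_sum
            (fun j _ => sq_nonneg (gradMat n x i j)) (Finset.mem_univ 2))) hK₂.le
      have h₂ := le_OseenFrankDensityAlg K₄ hK₁ hK₃ (hunit x) (gradMat n x)
      simp only [Pi.add_apply, OFdensity]
      linarith
  · have htwist : (fun x : Fin 3 → ℝ => ![Real.cos (α + (β - α) * x 2 / d),
        Real.sin (α + (β - α) * x 2 / d), 0]) = twist α ω := by
      funext x
      rw [twist, hω, div_mul_eq_mul_div]
    simp only [htwist, OFdensity_twist]
    rw [setIntegral_const, volume_real_box hl₁.le hl₂.le hd.le, smul_eq_mul, henergy]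
end
end
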